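/- Suppose there exists ω ∈ ℝ such that q(u) → ω as u → −∞ and as u → +∞, and q(u) > ω for all |u| sufficiently large. Then there exists s₀ ∈ (ω, +∞) such that: for s > s₀ the equation (WE_s) has no T-periodic solutions; for s = s₀ it has at least one T-periodic solution; and for ω < s < s₀ it has at least two T-periodic solutions. Moreover, if q(u) > ω for all u ∈ ℝ, then for s ≤ ω the equation (WE_s) has no T-periodic solutions. -/

import Mathlib

open MeasureTheory Set Filter

noncomputable section

/-- The Lebesgue measure restricted to the interval `[0,T]`. -/
def muT (T : ℝ) : Measure ℝ := volume.restrict (Icc 0 T)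

/-- `u` is a `C¹` function on `[0,T]` with derivative `u'` there, satisfying the
`T`-periodic boundary conditions `u 0 = u T` and `u' 0 = u' T`. -/
def IsC1Periodic (T : ℝ) (u u' : ℝ → ℝ) : Prop :=
  (∀ t ∈ Icc (0:ℝ) T, HasDerivWithinAt u (u' t) (Icc (0:ℝ) T) t) ∧
    ContinuousOn u' (Icc (0:ℝ) T) ∧ u 0 = u T ∧ u' 0 = u' T

/-- `φ ∘ u'` is absolutely continuous on `[0,T]`, being the indefinite integral of the
integrable function `w` (which is then its a.e. derivative). -/
def IsACPhiDeriv (T : ℝ) (φ : ℝ → ℝ) (u' w : ℝ → ℝ) : Prop :=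
  IntegrableOn w (Icc (0:ℝ) T) ∧
    ∀ t ∈ Icc (0:ℝ) T, φ (u' t) = φ (u' 0) + ∫ τ in (0:ℝ)..t, w τ

/-- `u` is a `T`-periodic solution of `(φ(u'))' + f(u)u' + a(t) q(u) = s + e(t)`. -/
def IsSolWE (T : ℝ) (φ f q a e : ℝ → ℝ) (s : ℝ) (u : ℝ → ℝ) : Prop :=
  ∃ u' w : ℝ → ℝ, IsC1Periodic T u u' ∧ IsACPhiDeriv T φ u' w ∧
    ∀ᵐ t ∂(muT T), w t + f (u t) * u' t + a t * q (u t) = s + e t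

/-- A perturbation of the identity by a strict contraction is bijective. -/
theorem bijective_id_add_of_lipschitzWith {E : Type*} [NormedAddCommGroup E] [CompleteSpace E]
    {g : E → E} {c : NNReal} (hc : c < 1) (hg : LipschitzWith c g) :
    Function.Bijective fun x => x + g x := by
  constructor
  · intro x y hxy
    have h1 : x - y = g y - g x := by
      simp only at hxy
      rw [sub_eq_sub_iff_add_eq_add, hxy, add_comm]
    have h2 : dist x y ≤ c * dist x y := by
      calc dist x y = dist (g y) (g x) := by rw [dist_eq_norm, h1, ← dist_eq_norm]
        _ ≤ c * dist x y := by rw [dist_comm x y]; exact hg.dist_le_mul y x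
    have h3 : (c : ℝ) < 1 := by exact_mod_cast hc
    have h4 : dist x y = 0 := by nlinarith [dist_nonneg (x := x) (y := y)]
    exact dist_eq_zero.1 h4
  · intro y
    have hcw : ContractingWith c fun x => y - g x := by
      refine ⟨hc, LipschitzWith.of_dist_le_mul fun a b => ?_⟩
      have := hg.dist_le_mul a b
      rwa [dist_sub_left]
    refine ⟨hcw.fixedPoint, ?_⟩
    have := hcw.fixedPoint_isFixedPt
    simp only [Function.IsFixedPt] at this
    exact (eq_sub_iff_add_eq.1 this.symm)

/-- A map which is Lipschitz on the closed unit ball and vanishes on the unit sphere remains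
Lipschitz when extended by zero. -/
theorem lipschitzWith_indicator_closedBall {E F : Type*} [NormedAddCommGroup E] [NormedSpace ℝ E]
    [NormedAddCommGroup F]
    {h : E → F} {c : NNReal} (hh : LipschitzOnWith c h (Metric.closedBall 0 1))
    (h0 : ∀ x, ‖x‖ = 1 → h x = 0) :
    LipschitzWith c ((Metric.closedBall (0 : E) 1).indicator h) := by
  have key : ∀ x y : E, ‖x‖ ≤ 1 → 1 < ‖y‖ → ‖h x‖ ≤ c * dist x y := by
    intro x y hx hy
    have hcont : ContinuousOn (fun t : ℝ => ‖AffineMap.lineMap x y t‖) (Icc 0 1) := by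
      have : Continuous (AffineMap.lineMap (k := ℝ) x y : ℝ → E) := AffineMap.lineMap_continuous
      exact this.norm.continuousOn
    obtain ⟨t, ht, htz⟩ := intermediate_value_Icc zero_le_one hcont
      (show (1 : ℝ) ∈ Icc _ _ by simp; exact ⟨hx, hy.le⟩)
    set z : E := AffineMap.lineMap x y t
    have h1 := hh.dist_le_mul x (by simpa using hx) z
      (by simp only [mem_closedBall_zero_iff]; exact htz.le)
    rw [h0 z htz, dist_zero_right] at h1
    refine h1.trans (mul_le_mul_of_nonneg_left ?_ c.2)
    rw [dist_left_lineMap]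
    have : ‖t‖ ≤ 1 := by rw [Real.norm_eq_abs, abs_le]; constructor <;> linarith [ht.1, ht.2]
    nlinarith [dist_nonneg (x := x) (y := y)]
  refine LipschitzWith.of_dist_le_mul fun x y => ?_
  by_cases hx : x ∈ Metric.closedBall (0 : E) 1 <;> by_cases hy : y ∈ Metric.closedBall (0 : E) 1
  · rw [indicator_of_mem hx, indicator_of_mem hy]; exact hh.dist_le_mul x hx y hy
  · rw [indicator_of_mem hx, indicator_of_notMem hy, dist_zero_right]
    exact key x y (by simpa using hx) (by simpa using hy)
  · rw [indicator_of_notMem hx, indicator_of_mem hy, dist_zero_left, dist_comm]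
    exact key y x (by simpa using hy) (by simpa using hx)
  · rw [indicator_of_notMem hx, indicator_of_notMem hy, dist_self]
    positivity

/-- `t ↦ det (1 + t A)` is a polynomial of degree at most the dimension. -/
theorem exists_polynomial_eval_eq_det_id_add_smul {E : Type*} [NormedAddCommGroup E]
    [NormedSpace ℝ E] [FiniteDimensional ℝ E] (A : E →L[ℝ] E) :
    ∃ p : Polynomial ℝ, p.natDegree ≤ Module.finrank ℝ E ∧
      ∀ t : ℝ, p.eval t = (ContinuousLinearMap.id ℝ E + t • A).det := by
  classical
  let b := Module.finBasis ℝ E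
  let M := LinearMap.toMatrix b b (A : E →ₗ[ℝ] E)
  refine ⟨Matrix.det ((Polynomial.X : Polynomial ℝ) • M.map Polynomial.C +
    (1 : Matrix _ _ ℝ).map Polynomial.C), ?_, fun t => ?_⟩
  · simpa using Polynomial.natDegree_det_X_add_C_le M 1
  · have h1 : (ContinuousLinearMap.id ℝ E + t • A).det
        = LinearMap.det (LinearMap.id + t • (A : E →ₗ[ℝ] E)) := rfl
    rw [h1, ← LinearMap.det_toMatrix b, map_add, LinearMap.toMatrix_id, map_smul]
    rw [← Polynomial.coe_evalRingHom, RingHom.map_det]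
    congr 1
    ext i j
    simp only [RingHom.mapMatrix_apply, Matrix.map_apply, Matrix.add_apply, Matrix.smul_apply,
      smul_eq_mul, Polynomial.coe_evalRingHom, Polynomial.eval_add, Polynomial.eval_mul,
      Polynomial.eval_X, Polynomial.eval_C]
    rw [add_comm]

/-- If `‖A‖ < 1` then `1 + A` has positive determinant. -/
theorem det_id_add_pos {E : Type*} [NormedAddCommGroup E]
    [NormedSpace ℝ E] [FiniteDimensional ℝ E] (A : E →L[ℝ] E) (hA : ‖A‖ < 1) :
    0 < (ContinuousLinearMap.id ℝ E + A).det := by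
  obtain ⟨p, -, hp⟩ := exists_polynomial_eval_eq_det_id_add_smul A
  have hne : ∀ t ∈ Icc (0 : ℝ) 1, p.eval t ≠ 0 := by
    intro t ht h
    rw [hp] at h
    have h2 : LinearMap.det (LinearMap.id + t • (A : E →ₗ[ℝ] E)) = 0 := h
    obtain ⟨v, hv, hv0⟩ := Submodule.exists_mem_ne_zero_of_ne_bot
      (LinearMap.bot_lt_ker_of_det_eq_zero h2).ne'
    have h3 : v + t • A v = 0 := by simpa using hv
    have h4 : ‖v‖ = ‖t • A v‖ := by
      rw [← norm_neg (t • A v), ← eq_neg_of_add_eq_zero_left h3]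
    rw [norm_smul, Real.norm_eq_abs, abs_of_nonneg ht.1] at h4
    have h5 := A.le_opNorm v
    have h6 : 0 < ‖v‖ := norm_pos_iff.2 hv0
    nlinarith [ht.1, ht.2, norm_nonneg (A v), norm_nonneg A]
  have h0 : p.eval 0 = 1 := by
    rw [hp, zero_smul, add_zero]
    exact LinearMap.det_id
  by_contra! hcon
  have h1 : p.eval 1 ≤ 0 := by rw [hp]; simpa using hcon
  obtain ⟨t, ht, htz⟩ := intermediate_value_Icc' zero_le_one p.continuous.continuousOn
    (show (0 : ℝ) ∈ Icc _ _ from ⟨h1, by rw [h0]; exact zero_le_one⟩)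
  exact hne t ht htz

section Ball

variable {E : Type*} [NormedAddCommGroup E] [InnerProductSpace ℝ E] [FiniteDimensional ℝ E]

/-- There is no `C¹` retraction of the closed unit ball onto the unit sphere. -/
theorem not_exists_contDiff_retraction (r : E → E)
    (hr : ∀ x, ‖x‖ ≤ 1 → ContDiffAt ℝ 1 r x) (hr1 : ∀ x, ‖x‖ ≤ 1 → ‖r x‖ = 1)
    (hrid : ∀ x, ‖x‖ = 1 → r x = x) : False := by
  let _ : MeasurableSpace E := borel E
  have _ : BorelSpace E := ⟨rfl⟩
  set B : Set E := Metric.closedBall 0 1 with hB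
  have memB : ∀ x, x ∈ B ↔ ‖x‖ ≤ 1 := fun x => by simp [hB]
  have hBc : IsCompact B := isCompact_closedBall 0 1
  have hBm : MeasurableSet B := hBc.measurableSet
  set h : E → E := fun x => r x - x with hh
  have hhd : ∀ x ∈ B, ContDiffAt ℝ 1 h x := fun x hx =>
    (hr x ((memB x).1 hx)).sub contDiffAt_id
  have hfc : ContinuousOn (fderiv ℝ h) B := fun x hx =>
    (ContDiffAt.continuousAt_fderiv (hhd x hx) (by simp)).continuousWithinAt
  have hdiff : ∀ x ∈ B, DifferentiableAt ℝ h x := fun x hx => (hhd x hx).differentiableAt (by simp)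
  obtain ⟨C, hC⟩ := hBc.exists_bound_of_continuousOn hfc
  have hlip : LipschitzOnWith C.toNNReal h B :=
    (convex_closedBall (0 : E) 1).lipschitzOnWith_of_nnnorm_fderiv_le hdiff
      fun x hx => by
        rw [← NNReal.coe_le_coe, coe_nnnorm]
        exact (hC x hx).trans (Real.le_coe_toNNReal C)
  have hlip2 := lipschitzWith_indicator_closedBall hlip
    (fun x hx => by simp [hh, hrid x hx])
  set c : NNReal := C.toNNReal with hc
  have hcC : C ≤ c := Real.le_coe_toNNReal C
  -- volume is preserved for small times
  have hvol : ∀ t : ℝ, 0 ≤ t → t * c < 1 →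
      ∫ x in B, (ContinuousLinearMap.id ℝ E + t • fderiv ℝ h x).det =
        (volume : Measure E).real B := by
    intro t ht htc
    have hbij : Function.Bijective fun x => x + t • B.indicator h x := by
      refine bijective_id_add_of_lipschitzWith (c := ‖t‖₊ * c) ?_ ?_
      · rw [← NNReal.coe_lt_coe]; simpa [abs_of_nonneg ht] using htc
      · exact (lipschitzWith_smul t).comp hlip2
    have heq : EqOn (fun x => x + t • B.indicator h x) (fun x => x + t • h x) B := by
      intro x hx; simp [indicator_of_mem hx]
    have himg : (fun x => x + t • h x) '' B = B := by
      rw [← heq.image_eq]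
      have h1 : (fun x => x + t • B.indicator h x) '' Bᶜ = Bᶜ := by
        have : EqOn (fun x => x + t • B.indicator h x) id Bᶜ := by
          intro x hx; simp [indicator_of_notMem hx]
        rw [this.image_eq, image_id]
      rw [image_compl_eq hbij] at h1
      exact compl_injective h1
    have hinj : InjOn (fun x => x + t • h x) B := heq.injOn_iff.1 hbij.1.injOn
    have hder : ∀ x ∈ B, HasFDerivWithinAt (fun x => x + t • h x)
        (ContinuousLinearMap.id ℝ E + t • fderiv ℝ h x) B x := fun x hx =>
      ((hasFDerivAt_id x).add ((hdiff x hx).hasFDerivAt.const_smul t)).hasFDerivWithinAt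
    have := integral_image_eq_integral_abs_det_fderiv_smul volume hBm hder hinj (fun _ => (1 : ℝ))
    rw [himg] at this
    simp only [smul_eq_mul, mul_one, integral_const, MeasurableSet.univ, measureReal_restrict_apply,
      univ_inter] at this
    rw [this]
    refine setIntegral_congr_fun hBm fun x hx => ?_
    rw [abs_of_pos]
    apply det_id_add_pos
    rw [norm_smul, Real.norm_eq_abs, abs_of_nonneg ht]
    exact (mul_le_mul_of_nonneg_left ((hC x hx).trans hcC) ht).trans_lt htc
  -- hence for all times, by interpolation
  set n := Module.finrank ℝ E
  let v : ℕ → ℝ := fun i => (i : ℝ) / ((n + 1) * (c + 1))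
  have hn0 : (0 : ℝ) < (n + 1) * (c + 1) := by positivity
  have hvinj : InjOn v (Finset.range (n + 1)) := by
    intro i _ j _ hij
    have := (div_left_inj' hn0.ne').1 hij
    exact_mod_cast this
  have hv : ∀ i ∈ Finset.range (n + 1), 0 ≤ v i ∧ v i * c < 1 := by
    intro i hi
    have hi' : (i : ℝ) ≤ n := by exact_mod_cast Nat.lt_succ_iff.1 (Finset.mem_range.1 hi)
    refine ⟨by positivity, ?_⟩
    have hc0 : (0 : ℝ) ≤ c := c.2
    rw [div_mul_eq_mul_div, div_lt_one hn0]
    nlinarith [mul_le_mul_of_nonneg_right hi' hc0]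
  have hdetc : ∀ t : ℝ, ContinuousOn (fun x =>
      (ContinuousLinearMap.id ℝ E + t • fderiv ℝ h x).det) B := by
    intro t
    exact ContinuousLinearMap.continuous_det.comp_continuousOn
      (continuousOn_const.add (hfc.const_smul t))
  have hinterp : ∀ x, (ContinuousLinearMap.id ℝ E + (1 : ℝ) • fderiv ℝ h x).det =
      ∑ i ∈ Finset.range (n + 1), (ContinuousLinearMap.id ℝ E + v i • fderiv ℝ h x).det *
        (Lagrange.basis (Finset.range (n + 1)) v i).eval 1 := by
    intro x
    obtain ⟨p, hpd, hp⟩ := exists_polynomial_eval_eq_det_id_add_smul (fderiv ℝ h x)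
    have h1 := Lagrange.eq_interpolate (f := p) hvinj (by
      rw [Finset.card_range]
      exact (Polynomial.degree_le_natDegree).trans_lt (by exact_mod_cast Nat.lt_succ_of_le hpd))
    rw [← hp 1, h1, Lagrange.interpolate_apply, Polynomial.eval_finsetSum]
    refine Finset.sum_congr rfl fun i _ => ?_
    rw [Polynomial.eval_mul, Polynomial.eval_C, hp]
  have hone : ∑ i ∈ Finset.range (n + 1),
      (Lagrange.basis (Finset.range (n + 1)) v i).eval 1 = 1 := by
    rw [← Polynomial.eval_finsetSum, Lagrange.sum_basis hvinj (by simp), Polynomial.eval_one]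
  have hfinal : ∫ x in B, (ContinuousLinearMap.id ℝ E + (1 : ℝ) • fderiv ℝ h x).det
      = (volume : Measure E).real B := by
    simp_rw [hinterp]
    rw [integral_finsetSum _ fun i _ => ((hdetc (v i)).integrableOn_compact hBc).mul_const _]
    simp_rw [integral_mul_const]
    rw [Finset.sum_congr rfl fun i hi => by rw [hvol (v i) (hv i hi).1 (hv i hi).2],
      ← Finset.mul_sum, hone, mul_one]
  have hzero : ∀ x ∈ B, (ContinuousLinearMap.id ℝ E + (1 : ℝ) • fderiv ℝ h x).det = 0 := by
    intro x hx
    have hdr : HasFDerivAt r (ContinuousLinearMap.id ℝ E + (1 : ℝ) • fderiv ℝ h x) x := by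
      have := (hasFDerivAt_id x).add ((hdiff x hx).hasFDerivAt.const_smul (1 : ℝ))
      refine this.congr_of_eventuallyEq (Eventually.of_forall fun y => ?_)
      simp [hh]
    set A := ContinuousLinearMap.id ℝ E + (1 : ℝ) • fderiv ℝ h x
    have h1 : HasFDerivWithinAt (fun y => inner ℝ (r y) (r y)) _ B x :=
      (hdr.inner ℝ hdr).hasFDerivWithinAt
    have h2 : HasFDerivWithinAt (fun y => inner ℝ (r y) (r y)) (0 : E →L[ℝ] ℝ) B x := by
      refine (hasFDerivWithinAt_const (1 : ℝ) x B).congr (fun y hy => ?_) ?_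
      · rw [real_inner_self_eq_norm_sq, hr1 y ((memB y).1 hy), one_pow]
      · rw [real_inner_self_eq_norm_sq, hr1 x ((memB x).1 hx), one_pow]
    have hud : UniqueDiffWithinAt ℝ B x :=
      uniqueDiffOn_convex (convex_closedBall _ _)
        (by rw [interior_closedBall _ one_ne_zero]; exact Metric.nonempty_ball.2 one_pos) x hx
    have h3 := hud.eq h1 h2
    by_contra hdet
    obtain ⟨w, hw⟩ := (LinearMap.equivOfDetNeZero (A : E →ₗ[ℝ] E) hdet).surjective (r x)
    have hw' : A w = r x := hw
    have h4 := DFunLike.congr_fun h3 w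
    simp [fderivInnerCLM_apply, hw', hr1 x ((memB x).1 hx)] at h4
  have hpos : 0 < (volume : Measure E).real B := by
    rw [measureReal_def, ENNReal.toReal_pos_iff]
    exact ⟨Metric.measure_closedBall_pos _ _ one_pos, hBc.measure_lt_top⟩
  rw [setIntegral_congr_fun hBm hzero] at hfinal
  simp at hfinal
  linarith

/-- A `C¹` self-map of the closed unit ball has a fixed point. -/
theorem exists_fixedPoint_closedBall_of_contDiff (f : E → E) (hf : ContDiff ℝ 1 f)
    (hmaps : ∀ x, ‖x‖ ≤ 1 → ‖f x‖ ≤ 1) : ∃ x, ‖x‖ ≤ 1 ∧ f x = x := by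
  by_contra! hfix
  set d : E → E := fun x => x - f x with hd
  have hdC : ContDiff ℝ 1 d := contDiff_id.sub hf
  have hd0 : ∀ x, ‖x‖ ≤ 1 → 0 < ‖d x‖ ^ 2 := fun x hx => by
    have : d x ≠ 0 := sub_ne_zero.2 (hfix x hx).symm
    positivity
  set D : E → ℝ := fun x => inner ℝ x (d x) ^ 2 + ‖d x‖ ^ 2 * (1 - ‖x‖ ^ 2) with hD
  have hsph : ∀ x, ‖x‖ = 1 → 0 < inner ℝ x (d x) := fun x hx => by
    have h1 := hd0 x hx.le
    have h2 := hmaps x hx.le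
    have h3 : ‖x - f x‖ ^ 2 = ‖x‖ ^ 2 - 2 * inner ℝ x (f x) + ‖f x‖ ^ 2 := norm_sub_sq_real x (f x)
    have h4 : inner ℝ x (d x) = ‖x‖ ^ 2 - inner ℝ x (f x) := by
      rw [hd, inner_sub_right, real_inner_self_eq_norm_sq]
    have h5 : ‖f x‖ ^ 2 ≤ 1 := by nlinarith [norm_nonneg (f x)]
    simp only [hd] at h1
    rw [h4, hx]
    rw [h3, hx] at h1
    linarith
  have hDpos : ∀ x, ‖x‖ ≤ 1 → 0 < D x := fun x hx => by
    rcases hx.lt_or_eq with h | h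
    · have h1 := hd0 x hx
      have h2 : 0 < 1 - ‖x‖ ^ 2 := by nlinarith [norm_nonneg x]
      have := mul_pos h1 h2
      simp only [hD]; positivity
    · have := hsph x h
      simp only [hD, h]; norm_num; positivity
  set l : E → ℝ := fun x => (-inner ℝ x (d x) + Real.sqrt (D x)) / ‖d x‖ ^ 2 with hl
  refine not_exists_contDiff_retraction (fun x => x + l x • d x) (fun x hx => ?_) (fun x hx => ?_)
    fun x hx => ?_
  · have hi : ContDiff ℝ 1 fun x => (inner ℝ x (d x) : ℝ) := contDiff_id.inner ℝ hdC
    have hn : ContDiff ℝ 1 fun x => ‖d x‖ ^ 2 := hdC.norm_sq ℝ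
    have hDC : ContDiff ℝ 1 D :=
      (hi.pow 2).add (hn.mul (contDiff_const.sub (contDiff_id.norm_sq ℝ)))
    have hlC : ContDiffAt ℝ 1 l x :=
      (hi.contDiffAt.neg.add (hDC.contDiffAt.sqrt (hDpos x hx).ne')).div hn.contDiffAt
        (hd0 x hx).ne'
    exact contDiffAt_id.add (hlC.smul hdC.contDiffAt)
  · have h1 : ‖x + l x • d x‖ ^ 2 =
        ‖x‖ ^ 2 + 2 * (l x * inner ℝ x (d x)) + l x ^ 2 * ‖d x‖ ^ 2 := by
      rw [norm_add_sq_real, inner_smul_right, norm_smul, mul_pow, Real.norm_eq_abs, sq_abs]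
    have h2 : l x * ‖d x‖ ^ 2 = -inner ℝ x (d x) + Real.sqrt (D x) :=
      div_mul_cancel₀ _ (hd0 x hx).ne'
    have h3 : Real.sqrt (D x) ^ 2 = D x := Real.sq_sqrt (hDpos x hx).le
    have h4 : ‖x + l x • d x‖ ^ 2 = 1 := by
      rw [h1]
      have h5 := (hd0 x hx).ne'
      have h6 : ‖d x‖ ^ 2 * (‖x‖ ^ 2 + 2 * (l x * inner ℝ x (d x)) + l x ^ 2 * ‖d x‖ ^ 2)
          = ‖d x‖ ^ 2 * 1 := by
        have : Real.sqrt (D x) = l x * ‖d x‖ ^ 2 + inner ℝ x (d x) := by linarith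
        rw [this] at h3
        simp only [hD] at h3
        linarith
      exact mul_left_cancel₀ h5 h6
    nlinarith [norm_nonneg (x + l x • d x)]
  · have h1 : D x = inner ℝ x (d x) ^ 2 := by simp [hD, hx]
    have h2 : l x = 0 := by
      simp only [hl, h1, Real.sqrt_sq (hsph x hx).le]
      simp
    simp [h2]

/-- **Brouwer's fixed point theorem** for maps into the closed unit ball. -/
theorem exists_fixedPoint_of_norm_le_one (f : E → E) (hf : Continuous f)
    (hmaps : ∀ x, ‖f x‖ ≤ 1) : ∃ x, f x = x := by
  by_contra! hfix
  have hBc : IsCompact (Metric.closedBall (0 : E) 1) := isCompact_closedBall 0 1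
  obtain ⟨x₀, -, hx₀⟩ := hBc.exists_isMinOn ⟨0, by simp⟩
    (f := fun x => ‖f x - x‖) (by fun_prop)
  set δ := ‖f x₀ - x₀‖ with hδ
  have hδ0 : 0 < δ := norm_pos_iff.2 (sub_ne_zero.2 (hfix x₀))
  obtain ⟨g, hg, hgf, -⟩ := hf.exists_contDiff_approx 1 (ε := fun _ => δ / 4) continuous_const
    (fun _ => by positivity)
  have hk : 0 < 1 + δ / 4 := by positivity
  have hgn : ∀ x, ‖g x‖ ≤ 1 + δ / 4 := fun x => by
    have h1 := (hgf x).le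
    rw [dist_eq_norm] at h1
    have h2 := norm_le_norm_add_norm_sub' (g x) (f x)
    linarith [hmaps x]
  obtain ⟨x, hx, hgx⟩ := exists_fixedPoint_closedBall_of_contDiff (fun x => (1 + δ / 4)⁻¹ • g x)
    (contDiff_const.smul (by exact_mod_cast hg)) (fun x _ => by
      rw [norm_smul, norm_inv, Real.norm_of_nonneg hk.le, inv_mul_le_one₀ hk]
      exact hgn x)
  have h1 : g x = (1 + δ / 4) • x := by
    conv_rhs => rw [← hgx]
    rw [smul_inv_smul₀ hk.ne']
  have h2 : δ ≤ ‖f x - x‖ := hx₀ (by simpa using hx)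
  have h3 : ‖g x - f x‖ < δ / 4 := by rw [← dist_eq_norm]; exact hgf x
  have h4 : f x - x = -(g x - f x) + (δ / 4) • x := by rw [h1]; module
  have h5 : ‖f x - x‖ ≤ ‖g x - f x‖ + δ / 4 := by
    rw [h4]
    refine (norm_add_le _ _).trans ?_
    rw [norm_neg, norm_smul, Real.norm_of_nonneg (by positivity)]
    nlinarith
  linarith

end Ball

/-- **Brouwer's fixed point theorem** on the standard simplex. -/
theorem exists_fixedPoint_stdSimplex {ι : Type*} [Fintype ι] [Nonempty ι] (f : (ι → ℝ) → ι → ℝ)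
    (hf : ContinuousOn f (stdSimplex ℝ ι)) (hmaps : MapsTo f (stdSimplex ℝ ι) (stdSimplex ℝ ι)) :
    ∃ x ∈ stdSimplex ℝ ι, f x = x := by
  let S : (ι → ℝ) → ℝ := fun x => ∑ i, max (x i) 0
  let m : ℝ := Fintype.card ι
  have hm : 0 < m := by simp only [m]; exact_mod_cast Fintype.card_pos
  let ρ : (ι → ℝ) → ι → ℝ := fun x i => (max (x i) 0 + max (1 - S x) 0 / m) / max 1 (S x)
  have hSc : Continuous S := by fun_prop
  have hρc : Continuous ρ := by
    refine continuous_pi fun i => ?_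
    refine Continuous.div (by fun_prop) (by fun_prop) fun x => ?_
    exact (lt_max_of_lt_left one_pos).ne'
  have hρm : ∀ x, ρ x ∈ stdSimplex ℝ ι := by
    intro x
    have hpos : 0 < max 1 (S x) := lt_max_of_lt_left one_pos
    refine ⟨fun i => ?_, ?_⟩
    · simp only [ρ]; positivity
    · simp only [ρ]
      rw [← Finset.sum_div, Finset.sum_add_distrib, div_eq_one_iff_eq hpos.ne', Finset.sum_const,
        Finset.card_univ, nsmul_eq_mul]
      change S x + m * (max (1 - S x) 0 / m) = _
      rw [mul_div_cancel₀ _ hm.ne']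
      rcases le_total (S x) 1 with h | h
      · rw [max_eq_left (sub_nonneg.2 h), max_eq_left h]; ring
      · rw [max_eq_right (sub_nonpos.2 h), max_eq_right h]; ring
  have hρid : ∀ x ∈ stdSimplex ℝ ι, ρ x = x := by
    intro x hx
    have h1 : S x = 1 := by
      rw [← hx.2]; exact Finset.sum_congr rfl fun i _ => max_eq_left (hx.1 i)
    ext i
    simp only [ρ, h1]
    simp [hx.1 i]
  have hc : Continuous fun x => f (ρ x) := hf.comp_continuous hρc hρm
  obtain ⟨x, hx⟩ := exists_fixedPoint_of_norm_le_one
    (fun x : EuclideanSpace ℝ ι => WithLp.toLp 2 (f (ρ (WithLp.ofLp x))))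
    ((PiLp.continuous_toLp 2 _).comp (hc.comp (PiLp.continuous_ofLp 2 _))) (fun x => by
      have h := hmaps (hρm (WithLp.ofLp x))
      rw [EuclideanSpace.norm_eq, Real.sqrt_le_one]
      calc ∑ i, ‖f (ρ (WithLp.ofLp x)) i‖ ^ 2 ≤ ∑ i, f (ρ (WithLp.ofLp x)) i := by
            refine Finset.sum_le_sum fun i hi => ?_
            have h0 := h.1 i
            have h1 : f (ρ (WithLp.ofLp x)) i ≤ 1 := by
              rw [← h.2]; exact Finset.single_le_sum (fun j _ => h.1 j) hi
            rw [Real.norm_eq_abs, sq_abs]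
            nlinarith
        _ = 1 := h.2)
  have hx' : f (ρ (WithLp.ofLp x)) = WithLp.ofLp x := congrArg WithLp.ofLp hx
  have hmem : WithLp.ofLp x ∈ stdSimplex ℝ ι := by rw [← hx']; exact hmaps (hρm _)
  exact ⟨_, hmem, by rwa [hρid _ hmem] at hx'⟩

/-- **Schauder's fixed point theorem** on a compact convex set. -/
theorem exists_fixedPoint_of_isCompact_convex {E : Type*} [NormedAddCommGroup E] [NormedSpace ℝ E]
    {K : Set E} (hK : IsCompact K) (hconv : Convex ℝ K) (hne : K.Nonempty) (f : E → E)
    (hf : ContinuousOn f K) (hmaps : MapsTo f K K) : ∃ x ∈ K, f x = x := by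
  by_contra! hfix
  obtain ⟨x₀, hx₀, hmin⟩ := hK.exists_isMinOn hne (f := fun x => ‖f x - x‖)
    (hf.sub continuousOn_id).norm
  set δ := ‖f x₀ - x₀‖ with hδ
  have hδ0 : 0 < δ := norm_pos_iff.2 (sub_ne_zero.2 (hfix x₀ hx₀))
  obtain ⟨t, htK, htf, hcov⟩ := hK.finite_cover_balls (half_pos hδ0)
  have hcov' : ∀ y ∈ K, ∃ i : t, dist y i < δ / 2 := fun y hy => by
    obtain ⟨i, hi, hyi⟩ := mem_iUnion₂.1 (hcov hy)
    exact ⟨⟨i, hi⟩, hyi⟩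
  have : Fintype t := htf.fintype
  have : Nonempty t := ⟨(hcov' x₀ hx₀).choose⟩
  let w : t → E → ℝ := fun i y => max 0 (δ / 2 - dist y i)
  let W : E → ℝ := fun y => ∑ i, w i y
  have hw0 : ∀ i y, 0 ≤ w i y := fun i y => le_max_left _ _
  have hwc : ∀ i, Continuous (w i) := fun i => by fun_prop
  have hWc : Continuous W := by fun_prop
  have hW0 : ∀ y ∈ K, 0 < W y := fun y hy => by
    obtain ⟨i, hi⟩ := hcov' y hy
    exact Finset.sum_pos' (fun j _ => hw0 j y)
      ⟨i, Finset.mem_univ _, lt_max_of_lt_right (by linarith)⟩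
  let P : (t → ℝ) → E := fun l => ∑ i, l i • (i : E)
  have hPc : Continuous P := by fun_prop
  have hPK : MapsTo P (stdSimplex ℝ t) K := fun l hl =>
    hconv.sum_mem (fun i _ => hl.1 i) hl.2 fun i _ => htK i.2
  have hfP : ContinuousOn (fun l => f (P l)) (stdSimplex ℝ t) := hf.comp hPc.continuousOn hPK
  obtain ⟨l, hl, hlf⟩ := exists_fixedPoint_stdSimplex (fun l i => w i (f (P l)) / W (f (P l)))
    (continuousOn_pi.2 fun i => ((hwc i).comp_continuousOn hfP).div (hWc.comp_continuousOn hfP)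
      fun l hl => (hW0 _ (hmaps (hPK hl))).ne')
    (fun l hl => ⟨fun i => div_nonneg (hw0 i _) (hW0 _ (hmaps (hPK hl))).le, by
      simp only
      rw [← Finset.sum_div]
      exact div_self (hW0 _ (hmaps (hPK hl))).ne'⟩)
  set y := f (P l) with hy
  have h1 : y - P l = ∑ i, l i • (y - (i : E)) := by
    simp only [smul_sub, Finset.sum_sub_distrib, ← Finset.sum_smul, hl.2, one_smul, P]
  have h2 : ‖y - P l‖ ≤ δ / 2 := by
    rw [h1]
    calc ‖∑ i, l i • (y - (i : E))‖ ≤ ∑ i, l i * (δ / 2) := by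
          refine norm_sum_le_of_le _ fun i _ => ?_
          rw [norm_smul, Real.norm_of_nonneg (hl.1 i)]
          by_cases hd : dist y i < δ / 2
          · rw [← dist_eq_norm]
            exact mul_le_mul_of_nonneg_left hd.le (hl.1 i)
          · have : l i = 0 := by
              rw [← hlf]
              simp only [w]
              rw [max_eq_left (by linarith), zero_div]
            simp [this]
      _ = δ / 2 := by rw [← Finset.sum_mul, hl.2, one_mul]
  have h3 : δ ≤ ‖y - P l‖ := hmin (hPK hl)
  linarith

/-- Intermediate value theorem along the fixed points of a one-parameter family of self-maps of a
compact convex set. -/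
theorem exists_fixedPoint_eq_zero {E : Type*} [NormedAddCommGroup E] [NormedSpace ℝ E]
    {K : Set E} (hK : IsCompact K) (hconv : Convex ℝ K) (hne : K.Nonempty) {L : ℝ} (hL : 0 ≤ L)
    (Φ : ℝ → E → E) (hΦ : ContinuousOn (fun p : ℝ × E => Φ p.1 p.2) (Icc (-L) L ×ˢ K))
    (hmaps : ∀ c ∈ Icc (-L) L, MapsTo (Φ c) K K)
    (g : ℝ → E → ℝ) (hg : ContinuousOn (fun p : ℝ × E => g p.1 p.2) (Icc (-L) L ×ˢ K))
    (hneg : ∀ u ∈ K, Φ (-L) u = u → g (-L) u < 0) (hpos : ∀ u ∈ K, Φ L u = u → 0 < g L u) :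
    ∃ c ∈ Icc (-L) L, ∃ u ∈ K, Φ c u = u ∧ g c u = 0 := by
  have hLL : -L ≤ L := by linarith
  obtain ⟨⟨c, u⟩, ⟨hc, hu⟩, hfix⟩ := exists_fixedPoint_of_isCompact_convex
    (isCompact_Icc.prod hK) ((convex_Icc (-L) L).prod hconv) ((nonempty_Icc.2 hLL).prod hne)
    (fun p => (max (-L) (min L (p.1 - g p.1 p.2)), Φ p.1 p.2))
    ((continuousOn_const.sup (continuousOn_const.inf (continuousOn_fst.sub hg))).prodMk hΦ)
    (fun p hp => ⟨⟨le_max_left _ _, max_le hLL (min_le_left _ _)⟩, hmaps p.1 hp.1 hp.2⟩)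
  simp only [Prod.mk.injEq] at hfix hc hu
  obtain ⟨h1, h2⟩ := hfix
  refine ⟨c, hc, u, hu, h2, ?_⟩
  rcases lt_trichotomy (g c u) 0 with h | h | h
  · exfalso
    have hcL : c = L := by
      by_contra hcL
      have hlt : c < L := lt_of_le_of_ne hc.2 hcL
      have : c < max (-L) (min L (c - g c u)) :=
        lt_max_of_lt_right (lt_min hlt (by linarith))
      linarith
    subst hcL
    exact absurd (hpos u hu h2) (by linarith)
  · exact h
  · exfalso
    have hcL : c = -L := by
      by_contra hcL
      have hlt : -L < c := lt_of_le_of_ne hc.1 (Ne.symm hcL)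
      have : max (-L) (min L (c - g c u)) < c :=
        max_lt hlt (min_lt_of_right_lt (by linarith))
      linarith
    subst hcL
    exact absurd (hneg u hu h2) (by linarith)

/-- A solution lying above a solution with a larger parameter does not touch it. -/
theorem IsSolWE.lt_of_le {T : ℝ} (hT : 0 < T) {φ f q a e : ℝ → ℝ} (hφmono : StrictMono φ)
    (hf : Continuous f) (hq : Continuous q) {C : ℝ} (ha : ∀ t, |a t| ≤ C)
    {s s₁ : ℝ} (hs : s < s₁) {u α : ℝ → ℝ} (hu : IsSolWE T φ f q a e s u)
    (hα : IsSolWE T φ f q a e s₁ α) (hle : ∀ t ∈ Icc 0 T, α t ≤ u t) :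
    ∀ t ∈ Icc 0 T, α t < u t := by
  obtain ⟨u', wu, ⟨hud, hu'c, hu0, hu'0⟩, ⟨hwui, hwu⟩, hueq⟩ := hu
  obtain ⟨α', wα, ⟨hαd, hα'c, hα0, hα'0⟩, ⟨hwαi, hwα⟩, hαeq⟩ := hα
  by_contra! hcon
  obtain ⟨t₀, ht₀, hut₀⟩ := hcon
  have hvd : ∀ t ∈ Icc 0 T, HasDerivWithinAt (fun t => u t - α t) (u' t - α' t) (Icc 0 T) t :=
    fun t ht => (hud t ht).sub (hαd t ht)
  have hdir : ∀ t ∈ Icc 0 T, u t = α t → ∀ y, t + y ∈ Icc 0 T → 0 ≤ y * (u' t - α' t) := by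
    intro t ht htu y hy
    have hmin : IsLocalMinOn (fun t => u t - α t) (Icc 0 T) t := by
      refine IsMinOn.localize fun r hr => ?_
      have := hle r hr
      simp only [mem_ofPred_eq, htu]; linarith
    have := hmin.hasFDerivWithinAt_nonneg (hvd t ht).hasFDerivWithinAt
      (mem_posTangentConeAt_of_segment_subset ((convex_Icc 0 T).segment_subset ht hy))
    simpa using this
  have h0 : (0 : ℝ) ∈ Icc 0 T := left_mem_Icc.2 hT.le
  have hTm : T ∈ Icc 0 T := right_mem_Icc.2 hT.le
  obtain ⟨t₁, ht₁, ht₁T, hut₁, hu't₁⟩ : ∃ t₁ ∈ Icc 0 T, t₁ < T ∧ u t₁ = α t₁ ∧ u' t₁ = α' t₁ := by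
    have heq : u t₀ = α t₀ := le_antisymm hut₀ (hle t₀ ht₀)
    by_cases hint : 0 < t₀ ∧ t₀ < T
    · refine ⟨t₀, ht₀, hint.2, heq, ?_⟩
      have h1 := hdir t₀ ht₀ heq (T - t₀) (by simpa using hT.le)
      have h2 := hdir t₀ ht₀ heq (-t₀) (by simpa using hT.le)
      nlinarith [hint.1, hint.2]
    · have heq0 : u 0 = α 0 := by
        rcases ht₀.1.eq_or_lt with h | h
        · rw [h]; exact heq
        · have : t₀ = T := le_antisymm ht₀.2 (not_lt.1 fun h' => hint ⟨h, h'⟩)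
          rw [hu0, hα0, ← this]; exact heq
      have heqT : u T = α T := by rw [← hu0, ← hα0, heq0]
      have h1 := hdir 0 h0 heq0 T (by simpa using hT.le)
      have h2 := hdir T hTm heqT (-T) (by simpa using hT.le)
      rw [← hu'0, ← hα'0] at h2
      exact ⟨0, h0, hT, heq0, by nlinarith⟩
  have huc : ContinuousOn u (Icc 0 T) := fun t ht => (hud t ht).continuousWithinAt
  have hαc : ContinuousOn α (Icc 0 T) := fun t ht => (hαd t ht).continuousWithinAt
  set ε := (s₁ - s) / 2 with hε
  have hε0 : 0 < ε := by simp only [hε]; linarith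
  have hρc : ContinuousOn (fun t => C * |q (α t) - q (u t)| + |f (α t) * α' t - f (u t) * u' t|)
      (Icc 0 T) := by
    have h1 := hq.comp_continuousOn huc
    have h2 := hq.comp_continuousOn hαc
    have h3 := hf.comp_continuousOn huc
    have h4 := hf.comp_continuousOn hαc
    exact (continuousOn_const.mul (h2.sub h1).abs).add ((h4.mul hα'c).sub (h3.mul hu'c)).abs
  obtain ⟨δ, hδ, hρ⟩ := Metric.continuousWithinAt_iff.1 (hρc t₁ ht₁) ε hε0
  obtain ⟨t₂, ht₁₂, ht₂T, ht₂δ⟩ : ∃ t₂, t₁ < t₂ ∧ t₂ ≤ T ∧ t₂ < t₁ + δ :=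
    ⟨min T (t₁ + δ / 2), lt_min ht₁T (by linarith), min_le_left _ _,
      (min_le_right _ _).trans_lt (by linarith)⟩
  have hsub : Icc t₁ t₂ ⊆ Icc 0 T := Icc_subset_Icc ht₁.1 ht₂T
  have hw : ∀ᵐ t ∂volume, t ∈ Icc t₁ t₂ → wu t - wα t ≤ -ε := by
    have h1 := (ae_restrict_iff' measurableSet_Icc).1 hueq
    have h2 := (ae_restrict_iff' measurableSet_Icc).1 hαeq
    filter_upwards [h1, h2] with t h1 h2 ht
    have e1 := h1 (hsub ht)
    have e2 := h2 (hsub ht)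
    have e3 := hρ (hsub ht) (by
      rw [Real.dist_eq, abs_of_nonneg (by linarith [ht.1])]; linarith [ht.2])
    simp only [hut₁, hu't₁, sub_self, abs_zero, mul_zero, add_zero, Real.dist_eq, sub_zero] at e3
    have e4 := (le_abs_self _).trans_lt e3
    have e5 : a t * (q (α t) - q (u t)) ≤ C * |q (α t) - q (u t)| := by
      refine (le_abs_self _).trans ?_
      rw [abs_mul]
      exact mul_le_mul_of_nonneg_right (ha t) (abs_nonneg _)
    have e6 := le_abs_self (f (α t) * α' t - f (u t) * u' t)
    have e7 : s₁ - s = 2 * ε := by simp only [hε]; ring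
    nlinarith
  have hlt : ∀ t ∈ Ioc t₁ t₂, u' t < α' t := by
    intro t ht
    have htI : t ∈ Icc 0 T := hsub ⟨ht.1.le, ht.2⟩
    have hint : ∀ {w : ℝ → ℝ}, IntegrableOn w (Icc 0 T) → ∀ x ∈ Icc 0 T, ∀ y ∈ Icc 0 T,
        IntervalIntegrable w volume x y := fun hw x hx y hy =>
      (hw.mono_set (uIcc_subset_Icc hx hy)).intervalIntegrable
    have e1 : ∫ τ in t₁..t, wu τ = φ (u' t) - φ (u' t₁) := by
      rw [hwu t htI, hwu t₁ ht₁, ← intervalIntegral.integral_interval_sub_left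
        (hint hwui 0 h0 t htI) (hint hwui 0 h0 t₁ ht₁)]
      ring
    have e2 : ∫ τ in t₁..t, wα τ = φ (α' t) - φ (α' t₁) := by
      rw [hwα t htI, hwα t₁ ht₁, ← intervalIntegral.integral_interval_sub_left
        (hint hwαi 0 h0 t htI) (hint hwαi 0 h0 t₁ ht₁)]
      ring
    have e3 : ∫ τ in t₁..t, (wu τ - wα τ) ≤ ∫ _τ in t₁..t, -ε := by
      refine intervalIntegral.integral_mono_ae_restrict ht.1.le
        ((hint hwui t₁ ht₁ t htI).sub (hint hwαi t₁ ht₁ t htI)) (by simp) ?_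
      refine (ae_restrict_iff' measurableSet_Icc).2 ?_
      filter_upwards [hw] with τ hτ hτt
      exact hτ ⟨hτt.1, hτt.2.trans ht.2⟩
    rw [intervalIntegral.integral_sub (hint hwui t₁ ht₁ t htI) (hint hwαi t₁ ht₁ t htI), e1, e2,
      hu't₁, intervalIntegral.integral_const, smul_eq_mul] at e3
    have : 0 < (t - t₁) * ε := mul_pos (by linarith [ht.1]) hε0
    exact hφmono.lt_iff_lt.1 (by linarith)
  have hanti : StrictAntiOn (fun t => u t - α t) (Icc t₁ t₂) := by
    refine strictAntiOn_of_deriv_neg (convex_Icc _ _) ((huc.sub hαc).mono hsub) fun t ht => ?_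
    rw [interior_Icc] at ht
    have h1 : HasDerivAt (fun t => u t - α t) (u' t - α' t) t :=
      (hvd t (hsub (Ioo_subset_Icc_self ht))).hasDerivAt
        (Icc_mem_nhds (ht₁.1.trans_lt ht.1) (ht.2.trans_le ht₂T))
    rw [h1.deriv]
    linarith [hlt t ⟨ht.1, ht.2.le⟩]
  have := hanti (left_mem_Icc.2 ht₁₂.le) (right_mem_Icc.2 ht₁₂.le) ht₁₂
  have h2 := hle t₂ (hsub (right_mem_Icc.2 ht₁₂.le))
  simp only [hut₁] at this
  linarith

/-- The first integral of the equation: `u` is `T`-periodic, `s` is the mean value of `a q(u)`, and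
`u' = ψ(k + ∫ (s + e - a q(u)) - G(u))` for some constant `k`. -/
def IsLienardSol (T : ℝ) (ψ G q a e : ℝ → ℝ) (s : ℝ) (u : ℝ → ℝ) : Prop :=
  u 0 = u T ∧ ∫ τ in (0:ℝ)..T, (s + e τ - a τ * q (u τ)) = 0 ∧
    ∃ k : ℝ, ∀ t ∈ Icc (0:ℝ) T, HasDerivWithinAt u
      (ψ (k + (∫ τ in (0:ℝ)..t, (s + e τ - a τ * q (u τ))) - G (u t))) (Icc (0:ℝ) T) t

theorem Measurable.integrableOn_Icc_of_abs_le {a : ℝ → ℝ} (ham : Measurable a) {C : ℝ}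
    (ha : ∀ t, |a t| ≤ C) (T : ℝ) : IntegrableOn a (Icc 0 T) :=
  Measure.integrableOn_of_bounded (M := C) measure_Icc_lt_top.ne
    ham.aestronglyMeasurable (Eventually.of_forall ha)

theorem integrableOn_forcing {T : ℝ} {q a e u : ℝ → ℝ} (hq : Continuous q)
    (ham : Measurable a) {Ca : ℝ} (ha : ∀ t, |a t| ≤ Ca)
    (hem : Measurable e) {Ce : ℝ} (he : ∀ t, |e t| ≤ Ce)
    (hu : ContinuousOn u (Icc 0 T)) (s : ℝ) :
    IntegrableOn (fun τ => s + e τ - a τ * q (u τ)) (Icc 0 T) :=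
  ((integrableOn_const measure_Icc_lt_top.ne).add (hem.integrableOn_Icc_of_abs_le he T)).sub
    ((ham.integrableOn_Icc_of_abs_le ha T).mul_continuousOn (hq.comp_continuousOn hu)
      isCompact_Icc)

theorem MeasureTheory.IntegrableOn.intervalIntegrable_of_mem {T : ℝ} {w : ℝ → ℝ}
    (hw : IntegrableOn w (Icc 0 T)) {x y : ℝ} (hx : x ∈ Icc 0 T) (hy : y ∈ Icc 0 T) :
    IntervalIntegrable w volume x y :=
  (hw.mono_set (uIcc_subset_Icc hx hy)).intervalIntegrable

/-- Fundamental theorem of calculus with one-sided derivatives at the end points. -/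
theorem integral_eq_sub_of_hasDerivWithinAt_Icc {T : ℝ} {v v' : ℝ → ℝ}
    (hv : ∀ t ∈ Icc 0 T, HasDerivWithinAt v (v' t) (Icc 0 T) t) (hv' : ContinuousOn v' (Icc 0 T))
    {t : ℝ} (ht : t ∈ Icc 0 T) : ∫ τ in (0:ℝ)..t, v' τ = v t - v 0 := by
  have hsub : Icc 0 t ⊆ Icc 0 T := Icc_subset_Icc_right ht.2
  refine intervalIntegral.integral_eq_sub_of_hasDerivAt_of_le ht.1
    (fun r hr => ((hv r (hsub hr)).continuousWithinAt).mono hsub) (fun r hr => ?_)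
    ((hv'.mono hsub).intervalIntegrable_of_Icc ht.1)
  exact (hv r (hsub (Ioo_subset_Icc_self hr))).hasDerivAt
    (Icc_mem_nhds hr.1 (hr.2.trans_le ht.2))

section

variable {T : ℝ} {φ ψ f F q a e : ℝ → ℝ}

theorem isSolWE_iff_isLienardSol (hT : 0 < T)
    (hφψ : ∀ y, φ (ψ y) = y) (hψφ : ∀ x, ψ (φ x) = x) (hψc : Continuous ψ)
    (hf : Continuous f) (hF : ∀ x, HasDerivAt F (f x) x) (hq : Continuous q)
    (ham : Measurable a) {Ca : ℝ} (ha : ∀ t, |a t| ≤ Ca)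
    (hem : Measurable e) {Ce : ℝ} (he : ∀ t, |e t| ≤ Ce) (s : ℝ) (u : ℝ → ℝ) :
    IsSolWE T φ f q a e s u ↔ IsLienardSol T ψ F q a e s u := by
  have h0 : (0 : ℝ) ∈ Icc 0 T := left_mem_Icc.2 hT.le
  have hTm : T ∈ Icc 0 T := right_mem_Icc.2 hT.le
  have hfu : ∀ {u' : ℝ → ℝ}, (∀ t ∈ Icc 0 T, HasDerivWithinAt u (u' t) (Icc 0 T) t) →
      ContinuousOn u' (Icc 0 T) → ContinuousOn (fun t => f (u t) * u' t) (Icc 0 T) ∧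
      ∀ t ∈ Icc 0 T, ∫ τ in (0:ℝ)..t, f (u τ) * u' τ = F (u t) - F (u 0) := by
    intro u' hud hu'c
    have huc : ContinuousOn u (Icc 0 T) := fun t ht => (hud t ht).continuousWithinAt
    have hc : ContinuousOn (fun t => f (u t) * u' t) (Icc 0 T) :=
      (hf.comp_continuousOn huc).mul hu'c
    exact ⟨hc, fun t ht => integral_eq_sub_of_hasDerivWithinAt_Icc (v := fun t => F (u t))
      (fun r hr => (hF (u r)).comp_hasDerivWithinAt r (hud r hr)) hc ht⟩
  constructor
  · rintro ⟨u', w, ⟨hud, hu'c, hu0, hu'0⟩, ⟨hwi, hw⟩, heq⟩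
    have huc : ContinuousOn u (Icc 0 T) := fun t ht => (hud t ht).continuousWithinAt
    obtain ⟨hfc, hfi⟩ := hfu hud hu'c
    have hforc := integrableOn_forcing hq ham ha hem he huc s
    have key : ∀ t ∈ Icc 0 T, φ (u' t) = φ (u' 0) + F (u 0) +
        (∫ τ in (0:ℝ)..t, (s + e τ - a τ * q (u τ))) - F (u t) := by
      intro t ht
      have h1 : ∫ τ in (0:ℝ)..t, w τ =
          ∫ τ in (0:ℝ)..t, ((s + e τ - a τ * q (u τ)) - f (u τ) * u' τ) := by
        refine intervalIntegral.integral_congr_ae ?_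
        filter_upwards [(ae_restrict_iff' measurableSet_Icc).1 heq] with τ hτ hτt
        rw [uIoc_of_le ht.1] at hτt
        have := hτ ⟨hτt.1.le, hτt.2.trans ht.2⟩
        linarith
      rw [hw t ht, h1, intervalIntegral.integral_sub (hforc.intervalIntegrable_of_mem h0 ht)
        ((hfc.integrableOn_Icc).intervalIntegrable_of_mem h0 ht), hfi t ht]
      ring
    refine ⟨hu0, ?_, φ (u' 0) + F (u 0), fun t ht => ?_⟩
    · have := key T hTm
      rw [← hu'0, ← hu0] at this
      linarith
    · rw [← key t ht, hψφ]; exact hud t ht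
  · rintro ⟨hu0, hH, k, hud⟩
    have huc : ContinuousOn u (Icc 0 T) := fun t ht => (hud t ht).continuousWithinAt
    have hforc := integrableOn_forcing hq ham ha hem he huc s
    set H : ℝ → ℝ := fun t => ∫ τ in (0:ℝ)..t, (s + e τ - a τ * q (u τ)) with hHdef
    set u' : ℝ → ℝ := fun t => ψ (k + H t - F (u t)) with hu'
    have hHc : ContinuousOn H (Icc 0 T) := by
      have := intervalIntegral.continuousOn_primitive_interval (a := 0) (b := T)
        (f := fun τ => s + e τ - a τ * q (u τ)) (μ := volume) (by rwa [uIcc_of_le hT.le])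
      rwa [uIcc_of_le hT.le] at this
    have hFc : Continuous F := continuous_iff_continuousAt.2 fun x => (hF x).continuousAt
    have hu'c : ContinuousOn u' (Icc 0 T) :=
      hψc.comp_continuousOn ((continuousOn_const.add hHc).sub (hFc.comp_continuousOn huc))
    obtain ⟨hfc, hfi⟩ := hfu hud hu'c
    have hH0 : H 0 = 0 := by simp [hHdef]
    refine ⟨u', fun t => (s + e t - a t * q (u t)) - f (u t) * u' t, ⟨hud, hu'c, hu0, ?_⟩,
      ⟨hforc.sub hfc.integrableOn_Icc, fun t ht => ?_⟩, Eventually.of_forall fun t => by ring⟩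
    · simp only [hu', ← hu0, hH0]
      rw [show H T = 0 from hH]
    · rw [intervalIntegral.integral_sub (hforc.intervalIntegrable_of_mem h0 ht)
        ((hfc.integrableOn_Icc).intervalIntegrable_of_mem h0 ht), hfi t ht]
      simp only [hu', hφψ, hH0]
      simp only [hHdef]
      ring

theorem IsLienardSol.congr {G G₁ : ℝ → ℝ} {s : ℝ} {u u₁ : ℝ → ℝ} (hT : 0 < T)
    (hu : IsLienardSol T ψ G q a e s u) (hG : ∀ t ∈ Icc 0 T, G (u t) = G₁ (u t))
    (huu : EqOn u u₁ (Icc 0 T)) : IsLienardSol T ψ G₁ q a e s u₁ := by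
  obtain ⟨hu0, hH, k, hk⟩ := hu
  have h0 : (0 : ℝ) ∈ Icc 0 T := left_mem_Icc.2 hT.le
  have hTm : T ∈ Icc 0 T := right_mem_Icc.2 hT.le
  have hint : ∀ t ∈ Icc 0 T, ∫ τ in (0:ℝ)..t, (s + e τ - a τ * q (u₁ τ)) =
      ∫ τ in (0:ℝ)..t, (s + e τ - a τ * q (u τ)) := by
    intro t ht
    refine intervalIntegral.integral_congr fun τ hτ => ?_
    rw [uIcc_of_le ht.1] at hτ
    rw [huu ⟨hτ.1, hτ.2.trans ht.2⟩]
  refine ⟨by rw [← huu h0, ← huu hTm, hu0], by rw [hint T hTm, hH], k, fun t ht => ?_⟩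
  rw [hint t ht, ← huu ht, ← hG t ht]
  exact (hk t ht).congr (fun r hr => (huu hr).symm) (huu ht).symm

theorem IsLienardSol.eq_mean {G : ℝ → ℝ} {s : ℝ} {u : ℝ → ℝ} (hT : 0 < T)
    (hq : Continuous q) (ham : Measurable a) {Ca : ℝ} (ha : ∀ t, |a t| ≤ Ca)
    (hem : Measurable e) {Ce : ℝ} (he : ∀ t, |e t| ≤ Ce) (he0 : ∫ t in (0:ℝ)..T, e t = 0)
    (hu : IsLienardSol T ψ G q a e s u) : s = (∫ t in (0:ℝ)..T, a t * q (u t)) / T := by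
  obtain ⟨hu0, hH, k, hk⟩ := hu
  have h0 : (0 : ℝ) ∈ Icc 0 T := left_mem_Icc.2 hT.le
  have hTm : T ∈ Icc 0 T := right_mem_Icc.2 hT.le
  have huc : ContinuousOn u (Icc 0 T) := fun t ht => (hk t ht).continuousWithinAt
  have h1 := (hem.integrableOn_Icc_of_abs_le he T).intervalIntegrable_of_mem h0 hTm
  have h2 : IntervalIntegrable (fun τ => a τ * q (u τ)) volume 0 T :=
    ((ham.integrableOn_Icc_of_abs_le ha T).mul_continuousOn (hq.comp_continuousOn huc)
      isCompact_Icc).intervalIntegrable_of_mem h0 hTm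
  have h3 : IntervalIntegrable (fun _ : ℝ => s) volume 0 T := by simp
  rw [intervalIntegral.integral_sub (h3.add h1) h2, intervalIntegral.integral_add h3 h1, he0,
    intervalIntegral.integral_const, smul_eq_mul] at hH
  rw [eq_div_iff hT.ne']
  linarith

/-- An increasing homeomorphism of the line is coercive. -/
theorem exists_mul_abs_le_mul_self_add (hφ : Monotone φ) (hφc : Continuous φ)
    (hφψ : ∀ y, φ (ψ y) = y) (C : ℝ) :
    ∃ B, 0 ≤ B ∧ ∀ x, C * |x| ≤ φ x * x + B := by
  obtain ⟨B, hB⟩ := (isCompact_Icc (a := min 0 (ψ (-C))) (b := max 0 (ψ C))).bddAbove_image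
    (f := fun x => C * |x| - φ x * x) (by fun_prop)
  refine ⟨max 0 B, le_max_left _ _, fun x => ?_⟩
  have hBm := le_max_right 0 B
  have hBm0 := le_max_left 0 B
  by_cases hx : x ∈ Icc (min 0 (ψ (-C))) (max 0 (ψ C))
  · have := hB (mem_image_of_mem _ hx)
    linarith
  · rw [mem_Icc, not_and_or, not_le, not_le] at hx
    rcases hx with hx | hx
    · have h1 : x < 0 := hx.trans_le (min_le_left _ _)
      have h2 : φ x ≤ -C := by
        rw [← hφψ (-C)]; exact hφ (hx.le.trans (min_le_right _ _))
      rw [abs_of_neg h1]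
      nlinarith
    · have h1 : 0 < x := (le_max_left _ _).trans_lt hx
      have h2 : C ≤ φ x := by
        rw [← hφψ C]; exact hφ ((le_max_right _ _).trans hx.le)
      rw [abs_of_pos h1]
      nlinarith

theorem abs_integral_forcing_le {s Ca Ce Cq : ℝ} {u : ℝ → ℝ} (ha : ∀ t, |a t| ≤ Ca)
    (he : ∀ t, |e t| ≤ Ce) (hqb : ∀ x, |q x| ≤ Cq) (hs : |s| ≤ Ca * Cq) {t : ℝ}
    (ht : t ∈ Icc 0 T) :
    |∫ τ in (0:ℝ)..t, (s + e τ - a τ * q (u τ))| ≤ (Ca * Cq + Ce + Ca * Cq) * T := by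
  have hCa : 0 ≤ Ca := (abs_nonneg _).trans (ha 0)
  have hCe : 0 ≤ Ce := (abs_nonneg _).trans (he 0)
  have hCq : 0 ≤ Cq := (abs_nonneg _).trans (hqb 0)
  have h1 := intervalIntegral.norm_integral_le_of_norm_le_const (a := 0) (b := t)
    (f := fun τ => s + e τ - a τ * q (u τ)) (C := Ca * Cq + Ce + Ca * Cq) (fun τ _ => by
      have : |a τ * q (u τ)| ≤ Ca * Cq := by
        rw [abs_mul]
        exact mul_le_mul (ha τ) (hqb _) (abs_nonneg _) hCa
      rw [Real.norm_eq_abs]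
      exact (abs_sub _ _).trans (add_le_add ((abs_add_le _ _).trans (add_le_add hs (he τ))) this))
  rw [Real.norm_eq_abs, sub_zero, abs_of_nonneg ht.1] at h1
  exact h1.trans (mul_le_mul_of_nonneg_left ht.2 (by positivity))

/-- A priori bound on the oscillation of solutions, independent of the damping term. -/
theorem exists_forall_isLienardSol_abs_sub_le (hT : 0 < T) (hφ : StrictMono φ)
    (hφc : Continuous φ) (hφψ : ∀ y, φ (ψ y) = y) (hψc : Continuous ψ) (hq : Continuous q)
    (ham : Measurable a) {Ca : ℝ} (ha : ∀ t, |a t| ≤ Ca)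
    (hem : Measurable e) {Ce : ℝ} (he : ∀ t, |e t| ≤ Ce) {Cq : ℝ} (hqb : ∀ x, |q x| ≤ Cq) :
    ∃ D, 0 ≤ D ∧ ∀ G : ℝ → ℝ, Continuous G → ∀ s u, |s| ≤ Ca * Cq →
      IsLienardSol T ψ G q a e s u →
      ∀ t ∈ Icc 0 T, |u t - u 0| ≤ D := by
  set C := (Ca * Cq + Ce + Ca * Cq) * T with hC
  obtain ⟨B, hB0, hB⟩ := exists_mul_abs_le_mul_self_add hφ.monotone hφc hφψ (C + 1)
  refine ⟨B * T, by positivity, fun G hG s u hs hu t ht => ?_⟩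
  obtain ⟨hu0, -, k, hud⟩ := hu
  have h0 : (0 : ℝ) ∈ Icc 0 T := left_mem_Icc.2 hT.le
  have hTm : T ∈ Icc 0 T := right_mem_Icc.2 hT.le
  have huc : ContinuousOn u (Icc 0 T) := fun t ht => (hud t ht).continuousWithinAt
  have hforc := integrableOn_forcing hq ham ha hem he huc s
  set H : ℝ → ℝ := fun t => ∫ τ in (0:ℝ)..t, (s + e τ - a τ * q (u τ)) with hHdef
  set u' : ℝ → ℝ := fun t => ψ (k + H t - G (u t)) with hu'
  have hHC : ∀ t ∈ Icc 0 T, |H t| ≤ C := fun t ht => abs_integral_forcing_le ha he hqb hs ht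
  have hHc : ContinuousOn H (Icc 0 T) := by
    have := intervalIntegral.continuousOn_primitive_interval (a := 0) (b := T)
      (f := fun τ => s + e τ - a τ * q (u τ)) (μ := volume) (by rwa [uIcc_of_le hT.le])
    rwa [uIcc_of_le hT.le] at this
  have hu'c : ContinuousOn u' (Icc 0 T) :=
    hψc.comp_continuousOn ((continuousOn_const.add hHc).sub (hG.comp_continuousOn huc))
  have hkc : ContinuousOn (fun τ => (k - G (u τ)) * u' τ) (Icc 0 T) :=
    (continuousOn_const.sub (hG.comp_continuousOn huc)).mul hu'c
  have hzero : ∫ τ in (0:ℝ)..T, (k - G (u τ)) * u' τ = 0 := by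
    rw [integral_eq_sub_of_hasDerivWithinAt_Icc
      (v := fun t => k * u t - ∫ x in (0:ℝ)..(u t), G x) (fun r hr => ?_) hkc hTm, hu0, sub_self]
    have h1 : HasDerivAt (fun y => ∫ x in (0:ℝ)..y, G x) (G (u r)) (u r) :=
      hG.integral_hasStrictDerivAt 0 (u r) |>.hasDerivAt
    have h2 : HasDerivWithinAt u (u' r) (Icc 0 T) r := hud r hr
    have h3 := (h2.const_mul k).sub (h1.comp_hasDerivWithinAt r h2)
    rw [← sub_mul] at h3
    exact h3
  have hii : ∀ {g : ℝ → ℝ}, ContinuousOn g (Icc 0 T) → IntervalIntegrable g volume 0 T :=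
    fun hg => hg.intervalIntegrable_of_Icc hT.le
  have hle : ∫ τ in (0:ℝ)..T, |u' τ| ≤ ∫ τ in (0:ℝ)..T, ((k - G (u τ)) * u' τ + B) := by
    refine intervalIntegral.integral_mono_on hT.le (hii hu'c.abs)
      ((hii hkc).add (by simp))
      fun r hr => ?_
    have h1 := hB (u' r)
    have h2 : φ (u' r) = k + H r - G (u r) := hφψ _
    have h3 : H r * u' r ≤ C * |u' r| := by
      refine (le_abs_self _).trans ?_
      rw [abs_mul]
      exact mul_le_mul_of_nonneg_right (hHC r hr) (abs_nonneg _)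
    rw [h2] at h1
    nlinarith
  rw [intervalIntegral.integral_add (hii hkc) (by simp), hzero,
    intervalIntegral.integral_const, smul_eq_mul, sub_zero, zero_add, mul_comm] at hle
  rw [← integral_eq_sub_of_hasDerivWithinAt_Icc hud hu'c ht]
  refine (intervalIntegral.abs_integral_le_integral_abs ht.1).trans (le_trans ?_ hle)
  exact intervalIntegral.integral_mono_interval le_rfl ht.1 ht.2
    (Eventually.of_forall fun _ => abs_nonneg _) (hii hu'c.abs)

end

section

variable {T : ℝ}

theorem isCompact_setOf_abs_le_lipschitzWith (T R : ℝ) (P : NNReal) :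
    IsCompact {v : C(Icc (0:ℝ) T, ℝ) | (∀ t, |v t| ≤ R) ∧ LipschitzWith P v} := by
  refine ArzelaAscoli.isCompact_of_equicontinuous _ ?_
    (LipschitzWith.uniformEquicontinuous _ P fun v => v.2.2).equicontinuous
  have himage : ContinuousMap.toFun '' {v : C(Icc (0:ℝ) T, ℝ) |
      (∀ t, |v t| ≤ R) ∧ LipschitzWith P v} =
      (univ.pi fun _ => Icc (-R) R) ∩ {v : Icc (0:ℝ) T → ℝ | LipschitzWith P v} := by
    ext v
    constructor
    · rintro ⟨w, ⟨hw, hwP⟩, rfl⟩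
      exact ⟨fun t _ => abs_le.1 (hw t), hwP⟩
    · rintro ⟨hv, hvP⟩
      exact ⟨⟨v, hvP.continuous⟩, ⟨fun t => abs_le.2 (hv t trivial), hvP⟩, rfl⟩
  rw [himage]
  refine (isCompact_univ_pi fun _ => isCompact_Icc).inter_right ?_
  simp only [lipschitzWith_iff_dist_le_mul, ofPred_forall]
  refine isClosed_iInter fun x => isClosed_iInter fun y => isClosed_le ?_ ?_ <;> fun_prop

theorem convex_setOf_abs_le_lipschitzWith (T R : ℝ) (P : NNReal) :
    Convex ℝ {v : C(Icc (0:ℝ) T, ℝ) | (∀ t, |v t| ≤ R) ∧ LipschitzWith P v} := by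
  rintro v ⟨hv, hvP⟩ w ⟨hw, hwP⟩ x y hx hy hxy
  rw [lipschitzWith_iff_dist_le_mul] at hvP hwP
  refine ⟨fun t => ?_, LipschitzWith.of_dist_le_mul fun t r => ?_⟩
  · have h := (convex_Icc (-R) R) (abs_le.1 (hv t)) (abs_le.1 (hw t)) hx hy hxy
    exact abs_le.2 h
  · have h := (convex_Icc (-(P * dist t r)) (P * dist t r)) (abs_le.1 (hvP t r))
      (abs_le.1 (hwP t r)) hx hy hxy
    have heq : (x • v + y • w) t - (x • v + y • w) r = x • (v t - v r) + y • (w t - w r) := by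
      simp only [ContinuousMap.add_apply, ContinuousMap.smul_apply, smul_eq_mul]
      ring
    rw [Real.dist_eq, heq]
    exact abs_le.2 h

theorem intervalIntegrable_mul_IccExtend (hT : 0 < T) {b : ℝ → ℝ} (hb : Measurable b) {C : ℝ}
    (hC : ∀ t, |b t| ≤ C) (g : C(Icc (0:ℝ) T, ℝ)) {x y : ℝ} (hx : x ∈ Icc 0 T)
    (hy : y ∈ Icc 0 T) :
    IntervalIntegrable (fun τ => b τ * IccExtend hT.le g τ) volume x y :=
  ((hb.integrableOn_Icc_of_abs_le hC T).mul_continuousOn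
    g.continuous.Icc_extend'.continuousOn isCompact_Icc).intervalIntegrable_of_mem hx hy

theorem abs_IccExtend_sub_le (hT : 0 < T) (g g' : C(Icc (0:ℝ) T, ℝ)) (τ : ℝ) :
    |IccExtend hT.le g τ - IccExtend hT.le g' τ| ≤ dist g g' :=
  ContinuousMap.dist_apply_le_dist (f := g) (g := g') (projIcc 0 T hT.le τ)

/-- Integration against a bounded weight is a continuous operator on `C([0,T])`. -/
theorem exists_primitive (hT : 0 < T) {b : ℝ → ℝ} (hb : Measurable b) {C : ℝ}
    (hC : ∀ t, |b t| ≤ C) :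
    ∃ J : C(Icc (0:ℝ) T, ℝ) → C(Icc (0:ℝ) T, ℝ), Continuous J ∧
      ∀ g t, J g t = ∫ τ in (0:ℝ)..t, b τ * IccExtend hT.le g τ := by
  have hC0 : 0 ≤ C := (abs_nonneg _).trans (hC 0)
  have h0 : (0 : ℝ) ∈ Icc 0 T := left_mem_Icc.2 hT.le
  have hTm : T ∈ Icc 0 T := right_mem_Icc.2 hT.le
  have hint := intervalIntegrable_mul_IccExtend hT hb hC
  have hc : ∀ g : C(Icc (0:ℝ) T, ℝ), Continuous fun t : Icc (0:ℝ) T =>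
      ∫ τ in (0:ℝ)..t, b τ * IccExtend hT.le g τ := by
    intro g
    have h := intervalIntegral.continuousOn_primitive_interval (a := 0) (b := T)
      (f := fun τ => b τ * IccExtend hT.le g τ) (μ := volume) (by
        rw [uIcc_of_le hT.le, integrableOn_Icc_iff_integrableOn_Ioc]
        exact (hint g h0 hTm).1)
    rw [uIcc_of_le hT.le] at h
    exact continuousOn_iff_continuous_domRestrict.1 h
  refine ⟨fun g => ⟨_, hc g⟩, ?_, fun g t => rfl⟩
  refine (LipschitzWith.of_dist_le_mul (K := ⟨C * T, mul_nonneg hC0 hT.le⟩)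
    fun g g' => ?_).continuous
  refine (ContinuousMap.dist_le (mul_nonneg (mul_nonneg hC0 hT.le) dist_nonneg)).2 fun t => ?_
  change |(∫ τ in (0:ℝ)..t, b τ * IccExtend hT.le g τ) -
    ∫ τ in (0:ℝ)..t, b τ * IccExtend hT.le g' τ| ≤ C * T * dist g g'
  rw [← intervalIntegral.integral_sub (hint g h0 t.2) (hint g' h0 t.2)]
  have h1 := intervalIntegral.norm_integral_le_of_norm_le_const (a := 0) (b := t)
    (f := fun τ => b τ * IccExtend hT.le g τ - b τ * IccExtend hT.le g' τ) (C := C * dist g g')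
    (fun τ _ => by
      rw [← mul_sub, Real.norm_eq_abs, abs_mul]
      exact mul_le_mul (hC τ) (abs_IccExtend_sub_le hT g g' τ) (abs_nonneg _) hC0)
  rw [Real.norm_eq_abs, sub_zero, abs_of_nonneg t.2.1] at h1
  refine h1.trans ?_
  have : C * dist g g' * t ≤ C * dist g g' * T :=
    mul_le_mul_of_nonneg_left t.2.2 (by positivity)
  linarith

/-- There is a constant, depending continuously on `h`, which makes `ψ(k + h)` have mean zero. -/
theorem exists_balance (hT : 0 < T) {ψ : ℝ → ℝ} (hψ : StrictMono ψ) (hψc : Continuous ψ)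
    (hψ0 : ψ 0 = 0) :
    ∃ k : C(Icc (0:ℝ) T, ℝ) → ℝ, Continuous k ∧ (∀ h, |k h| ≤ ‖h‖) ∧
      ∀ (h : C(Icc (0:ℝ) T, ℝ)) (c : ℝ),
        ∫ τ in (0:ℝ)..T, ψ (c + IccExtend hT.le h τ) = 0 ↔ c = k h := by
  have hc : ∀ (h : C(Icc (0:ℝ) T, ℝ)), Continuous (IccExtend hT.le h) :=
    fun h => h.continuous.Icc_extend'
  have hbd : ∀ (h : C(Icc (0:ℝ) T, ℝ)) τ, |IccExtend hT.le h τ| ≤ ‖h‖ :=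
    fun h τ => h.norm_coe_le_norm _
  have hex : ∀ h : C(Icc (0:ℝ) T, ℝ), ∃ k, ∫ τ in (0:ℝ)..T, ψ (k + IccExtend hT.le h τ) = 0 := by
    intro h
    have hcont : Continuous fun k => ∫ τ in (0:ℝ)..T, ψ (k + IccExtend hT.le h τ) :=
      intervalIntegral.continuous_parametric_intervalIntegral_of_continuous' (by
        have := hc h
        fun_prop) _ _
    have hle : ∫ τ in (0:ℝ)..T, ψ (-‖h‖ + IccExtend hT.le h τ) ≤ 0 := by
      have h2 : ∀ τ, 0 ≤ -ψ (-‖h‖ + IccExtend hT.le h τ) := fun τ => by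
        have : ψ (-‖h‖ + IccExtend hT.le h τ) ≤ ψ 0 :=
          hψ.monotone (by linarith [(abs_le.1 (hbd h τ)).2])
        linarith
      have h1 := intervalIntegral.integral_nonneg (μ := volume) hT.le fun τ _ => h2 τ
      rw [intervalIntegral.integral_neg] at h1
      linarith
    have hge : 0 ≤ ∫ τ in (0:ℝ)..T, ψ (‖h‖ + IccExtend hT.le h τ) := by
      refine intervalIntegral.integral_nonneg hT.le fun τ _ => ?_
      exact hψ0.symm.le.trans (hψ.monotone (by linarith [(abs_le.1 (hbd h τ)).1]))
    obtain ⟨k, -, hk⟩ := intermediate_value_Icc (a := -‖h‖) (b := ‖h‖)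
      (by linarith [norm_nonneg h]) hcont.continuousOn ⟨hle, hge⟩
    exact ⟨k, hk⟩
  choose k hk using hex
  have hle : ∀ {h h' : C(Icc (0:ℝ) T, ℝ)} {c c' : ℝ},
      ∫ τ in (0:ℝ)..T, ψ (c + IccExtend hT.le h τ) = 0 →
      ∫ τ in (0:ℝ)..T, ψ (c' + IccExtend hT.le h' τ) = 0 → c' ≤ c + dist h h' := by
    intro h h' c c' hch hch'
    by_contra! hlt
    have hpt : ∀ τ, ψ (c + IccExtend hT.le h τ) < ψ (c' + IccExtend hT.le h' τ) :=
      fun τ => hψ (by linarith [(abs_le.1 (abs_IccExtend_sub_le hT h h' τ)).2])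
    have h1 := hc h
    have h2 := hc h'
    have hlt' := intervalIntegral.integral_lt_integral_of_continuousOn_of_le_of_exists_lt hT
      (f := fun τ => ψ (c + IccExtend hT.le h τ)) (g := fun τ => ψ (c' + IccExtend hT.le h' τ))
      (by fun_prop) (by fun_prop) (fun τ _ => (hpt τ).le) ⟨0, left_mem_Icc.2 hT.le, hpt 0⟩
    rw [hch, hch'] at hlt'
    exact lt_irrefl _ hlt'
  have hlip : ∀ h h', |k h - k h'| ≤ dist h h' := fun h h' =>
    abs_sub_le_iff.2 ⟨by linarith [hle (hk h') (hk h), dist_comm h h'],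
      by linarith [hle (hk h) (hk h')]⟩
  have hk0 : k 0 = 0 := by
    have h1 := hk 0
    have h2 : IccExtend hT.le ⇑(0 : C(Icc (0:ℝ) T, ℝ)) = 0 := by ext; rfl
    simp only [h2, Pi.zero_apply, add_zero, intervalIntegral.integral_const, sub_zero,
      smul_eq_mul, mul_eq_zero, hT.ne', false_or] at h1
    exact hψ.injective (h1.trans hψ0.symm)
  refine ⟨k, ?_, fun h => ?_, fun h c => ⟨fun hc => ?_, fun hc => hc ▸ hk h⟩⟩
  · exact (LipschitzWith.of_dist_le_mul (K := 1) fun h h' => by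
      simpa [Real.dist_eq] using hlip h h').continuous
  · simpa [hk0] using hlip h 0
  · refine le_antisymm ?_ ?_
    · simpa using hle (hk h) hc
    · simpa using hle hc (hk h)

/-- The mean value over `[0,T]` of `a q(u)`, which is the only value of the parameter for which
`u` may be a periodic solution. -/
def weightedMean (hT : 0 < T) (q a : ℝ → ℝ) (u : C(Icc (0:ℝ) T, ℝ)) : ℝ :=
  (∫ τ in (0:ℝ)..T, a τ * q (IccExtend hT.le u τ)) / T

theorem abs_weightedMean_le (hT : 0 < T) {q a : ℝ → ℝ} {Ca Cq : ℝ} (ha : ∀ t, |a t| ≤ Ca)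
    (hqb : ∀ x, |q x| ≤ Cq) (u : C(Icc (0:ℝ) T, ℝ)) : |weightedMean hT q a u| ≤ Ca * Cq := by
  have h1 := intervalIntegral.norm_integral_le_of_norm_le_const (a := 0) (b := T)
    (f := fun τ => a τ * q (IccExtend hT.le u τ)) (C := Ca * Cq) (fun τ _ => by
      rw [Real.norm_eq_abs, abs_mul]
      exact mul_le_mul (ha τ) (hqb _) (abs_nonneg _) ((abs_nonneg _).trans (ha 0)))
  rw [Real.norm_eq_abs, sub_zero, abs_of_pos hT] at h1
  rwa [weightedMean, abs_div, abs_of_pos hT, div_le_iff₀ hT]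

theorem continuous_weightedMean (hT : 0 < T) {q a : ℝ → ℝ} (hq : Continuous q)
    (ham : Measurable a) {Ca : ℝ} (ha : ∀ t, |a t| ≤ Ca) :
    Continuous (weightedMean hT q a) := by
  obtain ⟨J, hJc, hJ⟩ := exists_primitive hT ham ha
  have heq : weightedMean hT q a =
      fun u => J ((⟨q, hq⟩ : C(ℝ, ℝ)).comp u) ⟨T, right_mem_Icc.2 hT.le⟩ / T := by
    ext u
    rw [hJ]
    rfl
  rw [heq]
  exact ((continuous_eval_const _).comp
    (hJc.comp (ContinuousMap.continuous_postcomp _))).div_const _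

/-- Periodic solutions with prescribed initial value are the fixed points of a compact operator
depending continuously on that value. -/
theorem exists_operator_isLienardSol (hT : 0 < T) {ψ G q a e : ℝ → ℝ} (hψ : StrictMono ψ)
    (hψc : Continuous ψ) (hψ0 : ψ 0 = 0) (hG : Continuous G) {CG : ℝ} (hGb : ∀ x, |G x| ≤ CG)
    (hq : Continuous q) (ham : Measurable a) {Ca : ℝ} (ha : ∀ t, |a t| ≤ Ca)
    (hem : Measurable e) {Ce : ℝ} (he : ∀ t, |e t| ≤ Ce) (he0 : ∫ t in (0:ℝ)..T, e t = 0)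
    {Cq : ℝ} (hqb : ∀ x, |q x| ≤ Cq) (L : ℝ) :
    ∃ (K : Set C(Icc (0:ℝ) T, ℝ)) (Φ : ℝ → C(Icc (0:ℝ) T, ℝ) → C(Icc (0:ℝ) T, ℝ)),
      IsCompact K ∧ Convex ℝ K ∧ Continuous (fun p : ℝ × C(Icc (0:ℝ) T, ℝ) => Φ p.1 p.2) ∧
      (∀ c ∈ Icc (-L) L, ∀ u, Φ c u ∈ K) ∧
      ∀ c u, Φ c u = u ↔
        IsLienardSol T ψ G q a e (weightedMean hT q a u) (IccExtend hT.le u) ∧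
          u ⟨0, left_mem_Icc.2 hT.le⟩ = c := by
  have h0 : (0 : ℝ) ∈ Icc 0 T := left_mem_Icc.2 hT.le
  have hTm : T ∈ Icc 0 T := right_mem_Icc.2 hT.le
  set σ := weightedMean hT q a with hσ
  have hσc : Continuous σ := continuous_weightedMean hT hq ham ha
  obtain ⟨Ja, hJac, hJa⟩ := exists_primitive hT ham ha
  obtain ⟨Je, -, hJe⟩ := exists_primitive hT hem he
  obtain ⟨J, hJc, hJ⟩ := exists_primitive hT (b := fun _ => 1) measurable_const (C := 1) (by simp)
  obtain ⟨k, hkc, hkb, hk⟩ := exists_balance hT hψ hψc hψ0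
  set qC : C(ℝ, ℝ) := ⟨q, hq⟩
  set GC : C(ℝ, ℝ) := ⟨G, hG⟩
  set ψC : C(ℝ, ℝ) := ⟨ψ, hψc⟩
  set H : C(Icc (0:ℝ) T, ℝ) → C(Icc (0:ℝ) T, ℝ) := fun u =>
    σ u • (⟨fun t => (t : ℝ), by fun_prop⟩ : C(Icc (0:ℝ) T, ℝ)) + Je 1 - Ja (qC.comp u)
      - GC.comp u with hHdef
  have hHc : Continuous H :=
    (((hσc.smul continuous_const).add continuous_const).sub
      (hJac.comp (ContinuousMap.continuous_postcomp _))).sub (ContinuousMap.continuous_postcomp _)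
  have hH : ∀ u t, H u t = (∫ τ in (0:ℝ)..t, (σ u + e τ - a τ * q (IccExtend hT.le u τ)))
      - G (u t) := by
    intro u t
    have h1 : Je 1 t = ∫ τ in (0:ℝ)..t, e τ := by
      rw [hJe]
      refine intervalIntegral.integral_congr fun τ _ => ?_
      change e τ * 1 = e τ
      rw [mul_one]
    have h2 : Ja (qC.comp u) t = ∫ τ in (0:ℝ)..t, a τ * q (IccExtend hT.le u τ) := hJa _ _
    have h3 : IntervalIntegrable (fun τ => a τ * q (IccExtend hT.le u τ)) volume 0 t :=
      intervalIntegrable_mul_IccExtend hT ham ha (qC.comp u) h0 t.2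
    have h4 : IntervalIntegrable e volume 0 t :=
      (hem.integrableOn_Icc_of_abs_le he T).intervalIntegrable_of_mem h0 t.2
    have h5 : IntervalIntegrable (fun _ : ℝ => σ u) volume 0 t := by simp
    rw [intervalIntegral.integral_sub (h5.add h4) h3, intervalIntegral.integral_add h5 h4, ← h1,
      ← h2, intervalIntegral.integral_const, sub_zero, smul_eq_mul, mul_comm]
    simp [hHdef, GC, mul_comm]
  have hmean : ∀ u, ∫ τ in (0:ℝ)..T, (σ u + e τ - a τ * q (IccExtend hT.le u τ)) = 0 := by
    intro u
    have h3 : IntervalIntegrable (fun τ => a τ * q (IccExtend hT.le u τ)) volume 0 T :=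
      intervalIntegrable_mul_IccExtend hT ham ha (qC.comp u) h0 hTm
    have h4 : IntervalIntegrable e volume 0 T :=
      (hem.integrableOn_Icc_of_abs_le he T).intervalIntegrable_of_mem h0 hTm
    have h5 : IntervalIntegrable (fun _ : ℝ => σ u) volume 0 T := by simp
    rw [intervalIntegral.integral_sub (h5.add h4) h3, intervalIntegral.integral_add h5 h4, he0,
      intervalIntegral.integral_const, sub_zero, smul_eq_mul, hσ, weightedMean,
      mul_div_cancel₀ _ hT.ne']
    ring
  set N := (Ca * Cq + Ce + Ca * Cq) * T + CG with hN
  have hHN : ∀ u t, |H u t| ≤ N := by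
    intro u t
    rw [hH]
    exact (abs_sub _ _).trans (add_le_add
      (abs_integral_forcing_le ha he hqb (abs_weightedMean_le hT ha hqb u) t.2) (hGb _))
  have hN0 : 0 ≤ N := (abs_nonneg _).trans (hHN 0 ⟨0, h0⟩)
  set g : C(Icc (0:ℝ) T, ℝ) → C(Icc (0:ℝ) T, ℝ) := fun u =>
    ψC.comp (ContinuousMap.const _ (k (H u)) + H u) with hgdef
  have hg : ∀ u t, IccExtend hT.le (g u) t = ψ (k (H u) + IccExtend hT.le (H u) t) :=
    fun u t => rfl
  have hgc : Continuous g := (ContinuousMap.continuous_postcomp _).comp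
    ((ContinuousMap.continuous_const'.comp (hkc.comp hHc)).add hHc)
  obtain ⟨P, hP⟩ := (isCompact_Icc (a := -(N + N)) (b := N + N)).exists_bound_of_continuousOn
    hψc.continuousOn
  have hP0 : 0 ≤ P := (norm_nonneg _).trans (hP 0 ⟨by linarith, by linarith⟩)
  lift P to NNReal using hP0
  have hgP : ∀ u t, |IccExtend hT.le (g u) t| ≤ P := by
    intro u t
    refine hP _ (abs_le.1 ((abs_add_le _ _).trans (add_le_add ?_ (hHN _ _))))
    exact (hkb _).trans ((ContinuousMap.norm_le _ hN0).2 (hHN u))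
  have hgi : ∀ u x y, IntervalIntegrable (IccExtend hT.le (g u)) volume x y :=
    fun u x y => (g u).continuous.Icc_extend'.intervalIntegrable x y
  have hJ' : ∀ u t, J u t = ∫ τ in (0:ℝ)..t, IccExtend hT.le u τ := by
    intro u t
    rw [hJ]
    simp
  have hLip : ∀ u, LipschitzWith P (J (g u)) := by
    refine fun u => LipschitzWith.of_dist_le_mul fun t r => ?_
    rw [Real.dist_eq, hJ', hJ', intervalIntegral.integral_interval_sub_left (hgi _ _ _)
      (hgi _ _ _)]
    exact intervalIntegral.norm_integral_le_of_norm_le_const (f := IccExtend hT.le (g u))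
      fun τ _ => hgP u τ
  refine ⟨{v | (∀ t, |v t| ≤ L + P * T) ∧ LipschitzWith P v},
    fun c u => ContinuousMap.const _ c + J (g u), isCompact_setOf_abs_le_lipschitzWith _ _ _,
    convex_setOf_abs_le_lipschitzWith _ _ _, ?_, fun c hc u => ⟨fun t => ?_, ?_⟩,
    fun c u => ⟨fun hfix => ?_, fun hsol => ?_⟩⟩
  · exact (ContinuousMap.continuous_const'.comp continuous_fst).add
      (hJc.comp (hgc.comp continuous_snd))
  · refine (abs_add_le _ _).trans (add_le_add (abs_le.2 hc) ?_)
    rw [hJ']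
    have h1 := intervalIntegral.norm_integral_le_of_norm_le_const (a := 0) (b := t)
      (f := IccExtend hT.le (g u)) fun τ _ => hgP u τ
    rw [sub_zero, abs_of_nonneg t.2.1] at h1
    exact h1.trans (mul_le_mul_of_nonneg_left t.2.2 P.2)
  · exact LipschitzWith.of_dist_le_mul fun t r =>
      (dist_add_left c _ _).trans_le ((hLip u).dist_le_mul t r)
  · have hv : ∀ t (ht : t ∈ Icc 0 T), u ⟨t, ht⟩ =
        c + ∫ τ in (0:ℝ)..t, IccExtend hT.le (g u) τ := by
      intro t ht
      conv_lhs => rw [← hfix]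
      rw [← hJ' (g u) ⟨t, ht⟩]
      rfl
    have hu0 : u ⟨0, h0⟩ = c := by rw [hv]; simp
    have huT : u ⟨T, hTm⟩ = c := by
      rw [hv]
      simp only [hg]
      rw [(hk _ _).2 rfl, add_zero]
    refine ⟨⟨?_, hmean u, k (H u), fun t ht => ?_⟩, hu0⟩
    · rw [IccExtend_of_mem _ _ h0, IccExtend_of_mem _ _ hTm, hu0, huT]
    · have h1 : HasDerivWithinAt (fun t => c + ∫ τ in (0:ℝ)..t, IccExtend hT.le (g u) τ)
          (IccExtend hT.le (g u) t) (Icc 0 T) t :=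
        (((g u).continuous.Icc_extend'.integral_hasStrictDerivAt 0
          t).hasDerivAt.const_add c).hasDerivWithinAt
      rw [hg, IccExtend_of_mem _ _ ht, hH, ← add_sub_assoc] at h1
      rw [IccExtend_of_mem _ _ ht]
      refine h1.congr (fun r hr => ?_) ?_
      · rw [IccExtend_of_mem _ _ hr, hv]
      · rw [IccExtend_of_mem _ _ ht, hv]
  · obtain ⟨⟨hu0, -, k', hk'⟩, hc⟩ := hsol
    have hd : ∀ t ∈ Icc 0 T, HasDerivWithinAt (IccExtend hT.le u)
        (ψ (k' + IccExtend hT.le (H u) t)) (Icc 0 T) t := by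
      intro t ht
      have h1 := hk' t ht
      rwa [IccExtend_of_mem _ _ ht, add_sub_assoc, ← hH u ⟨t, ht⟩,
        ← IccExtend_of_mem hT.le (H u) ht] at h1
    have hdc : Continuous fun t => ψ (k' + IccExtend hT.le (H u) t) := by
      have := (H u).continuous.Icc_extend' (h := hT.le)
      fun_prop
    have hint := fun {t : ℝ} (ht : t ∈ Icc 0 T) =>
      integral_eq_sub_of_hasDerivWithinAt_Icc hd hdc.continuousOn ht
    have hkk : k' = k (H u) := by
      refine (hk _ _).1 ?_
      rw [hint hTm, hu0, sub_self]
    ext t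
    have h2 := hint t.2
    rw [IccExtend_of_mem _ _ t.2, IccExtend_of_mem _ _ h0, hc, hkk] at h2
    change c + J (g u) t = u t
    rw [hJ']
    simp only [hg]
    rw [h2]
    simp

end

section

variable {T : ℝ}

theorem le_weightedMean (hT : 0 < T) {q a : ℝ → ℝ} (hq : Continuous q) (ham : Measurable a)
    {Ca : ℝ} (ha : ∀ t, |a t| ≤ Ca) (ha0 : ∀ t, 0 ≤ a t) (ha1 : ∫ t in (0:ℝ)..T, a t = T)
    {u : C(Icc (0:ℝ) T, ℝ)} {m : ℝ} (hm : ∀ t, m ≤ q (u t)) : m ≤ weightedMean hT q a u := by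
  have h0 : (0 : ℝ) ∈ Icc 0 T := left_mem_Icc.2 hT.le
  have hTm : T ∈ Icc 0 T := right_mem_Icc.2 hT.le
  have h1 : ∫ t in (0:ℝ)..T, a t * m ≤ ∫ t in (0:ℝ)..T, a t * q (IccExtend hT.le u t) :=
    intervalIntegral.integral_mono_on hT.le
      (((ham.integrableOn_Icc_of_abs_le ha T).intervalIntegrable_of_mem h0 hTm).mul_const m)
      (intervalIntegrable_mul_IccExtend hT ham ha ((⟨q, hq⟩ : C(ℝ, ℝ)).comp u) h0 hTm)
      fun t _ => mul_le_mul_of_nonneg_left (hm _) (ha0 t)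
  rw [intervalIntegral.integral_mul_const, ha1] at h1
  rwa [weightedMean, le_div_iff₀ hT, mul_comm]

theorem weightedMean_neg (hT : 0 < T) (q a : ℝ → ℝ) (u : C(Icc (0:ℝ) T, ℝ)) :
    weightedMean hT (-q) a u = -weightedMean hT q a u := by
  simp only [weightedMean, Pi.neg_apply, mul_neg, intervalIntegral.integral_neg, neg_div]

theorem lt_weightedMean (hT : 0 < T) {q a : ℝ → ℝ} (hq : Continuous q) (ham : Measurable a)
    {Ca : ℝ} (ha : ∀ t, |a t| ≤ Ca) (ha0 : ∀ t, 0 ≤ a t) (ha1 : ∫ t in (0:ℝ)..T, a t = T)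
    {u : C(Icc (0:ℝ) T, ℝ)} {m : ℝ} (hm : ∀ t, m < q (u t)) : m < weightedMean hT q a u := by
  have hne : (univ : Set (Icc (0:ℝ) T)).Nonempty := ⟨⟨0, left_mem_Icc.2 hT.le⟩, trivial⟩
  obtain ⟨t, -, ht⟩ := isCompact_univ.exists_isMinOn hne (hq.comp u.continuous).continuousOn
  exact (hm t).trans_le (le_weightedMean hT hq ham ha ha0 ha1 fun r => ht (mem_univ r))

theorem weightedMean_lt (hT : 0 < T) {q a : ℝ → ℝ} (hq : Continuous q) (ham : Measurable a)
    {Ca : ℝ} (ha : ∀ t, |a t| ≤ Ca) (ha0 : ∀ t, 0 ≤ a t) (ha1 : ∫ t in (0:ℝ)..T, a t = T)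
    {u : C(Icc (0:ℝ) T, ℝ)} {m : ℝ} (hm : ∀ t, q (u t) < m) : weightedMean hT q a u < m := by
  have h := lt_weightedMean hT hq.neg ham ha ha0 ha1 (u := u) (m := -m)
    fun t => neg_lt_neg (hm t)
  rw [weightedMean_neg] at h
  exact neg_lt_neg_iff.1 h

theorem exists_continuous_min {X : Type*} [TopologicalSpace X] [CompactSpace X] [Nonempty X] :
    ∃ m : C(X, ℝ) → ℝ, Continuous m ∧ (∀ u, ∃ t, m u = u t) ∧ ∀ u t, m u ≤ u t := by
  have hmin : ∀ u : C(X, ℝ), ∃ t, ∀ r, u t ≤ u r := fun u => by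
    obtain ⟨t, -, ht⟩ := isCompact_univ.exists_isMinOn univ_nonempty u.continuous.continuousOn
    exact ⟨t, fun r => ht (mem_univ r)⟩
  choose t ht using hmin
  refine ⟨fun u => u (t u), ?_, fun u => ⟨t u, rfl⟩, ht⟩
  refine (LipschitzWith.of_le_add fun u v => ?_).continuous
  have h1 := (abs_le.1 (ContinuousMap.dist_apply_le_dist (f := u) (g := v) (t v))).2
  linarith [ht u (t v)]

theorem IsSolWE.continuousOn {φ f q a e u : ℝ → ℝ} {s : ℝ} (hu : IsSolWE T φ f q a e s u) :
    ContinuousOn u (Icc 0 T) := by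
  obtain ⟨u', w, ⟨hud, -⟩, -⟩ := hu
  exact fun t ht => (hud t ht).continuousWithinAt

theorem exists_hasDerivAt_eq {f : ℝ → ℝ} (hf : Continuous f) :
    ∃ F : ℝ → ℝ, ∀ x, HasDerivAt F (f x) x :=
  ⟨fun x => ∫ y in (0:ℝ)..x, f y, fun x => (hf.integral_hasStrictDerivAt 0 x).hasDerivAt⟩

theorem exists_continuous_inverse {φ : ℝ → ℝ} (hφ : StrictMono φ) (hφs : Function.Surjective φ) :
    ∃ ψ : ℝ → ℝ, StrictMono ψ ∧ Continuous ψ ∧ (∀ y, φ (ψ y) = y) ∧ ∀ x, ψ (φ x) = x :=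
  ⟨(hφ.orderIsoOfSurjective φ hφs).symm, OrderIso.strictMono _, OrderIso.continuous _,
    hφ.orderIsoOfSurjective_self_symm_apply φ hφs, hφ.orderIsoOfSurjective_symm_apply_self φ hφs⟩

/-- Every periodic solution comes from an element of `C([0,T])`, and the parameter is determined
by it. -/
theorem IsSolWE.exists_continuousMap (hT : 0 < T) {φ f q a e : ℝ → ℝ} (hφ : StrictMono φ)
    (hφs : Function.Surjective φ) (hf : Continuous f) (hq : Continuous q) (ham : Measurable a)
    {Ca : ℝ} (ha : ∀ t, |a t| ≤ Ca) (hem : Measurable e) {Ce : ℝ} (he : ∀ t, |e t| ≤ Ce)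
    (he0 : ∫ t in (0:ℝ)..T, e t = 0) {s : ℝ} {v : ℝ → ℝ} (hv : IsSolWE T φ f q a e s v) :
    ∃ u : C(Icc (0:ℝ) T, ℝ), s = weightedMean hT q a u ∧
      IsSolWE T φ f q a e s (IccExtend hT.le u) := by
  obtain ⟨ψ, -, hψc, hφψ, hψφ⟩ := exists_continuous_inverse hφ hφs
  obtain ⟨F, hF⟩ := exists_hasDerivAt_eq hf
  have hiff := isSolWE_iff_isLienardSol hT hφψ hψφ hψc hf hF hq ham ha hem he s
  set u : C(Icc (0:ℝ) T, ℝ) := ⟨fun t => v t, hv.continuousOn.domRestrict⟩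
  have huv : EqOn v (IccExtend hT.le u) (Icc 0 T) := fun t ht => by
    rw [IccExtend_of_mem _ _ ht]
    rfl
  have hu := ((hiff v).1 hv).congr hT (fun _ _ => rfl) huv
  exact ⟨u, hu.eq_mean hT hq ham ha hem he he0, (hiff _).2 hu⟩

/-- Periodic solutions with initial value in a bounded interval are the fixed points of a compact
operator, and their oscillation is bounded a priori. -/
theorem exists_operator_isSolWE (hT : 0 < T) {φ f q a e : ℝ → ℝ} (hφ : StrictMono φ)
    (hφc : Continuous φ) (hφs : Function.Surjective φ) (hφ0 : φ 0 = 0) (hf : Continuous f)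
    (hq : Continuous q) (ham : Measurable a)
    {Ca : ℝ} (ha : ∀ t, |a t| ≤ Ca) (hem : Measurable e) {Ce : ℝ} (he : ∀ t, |e t| ≤ Ce)
    (he0 : ∫ t in (0:ℝ)..T, e t = 0) {Cq : ℝ} (hqb : ∀ x, |q x| ≤ Cq) :
    ∃ D : ℝ, (∀ u : C(Icc (0:ℝ) T, ℝ),
      IsSolWE T φ f q a e (weightedMean hT q a u) (IccExtend hT.le u) →
        ∀ t, |u t - u ⟨0, left_mem_Icc.2 hT.le⟩| ≤ D) ∧
      ∀ L : ℝ, ∃ (K : Set C(Icc (0:ℝ) T, ℝ)) (Φ : ℝ → C(Icc (0:ℝ) T, ℝ) → C(Icc (0:ℝ) T, ℝ)),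
        IsCompact K ∧ Convex ℝ K ∧ Continuous (fun p : ℝ × C(Icc (0:ℝ) T, ℝ) => Φ p.1 p.2) ∧
        (∀ c ∈ Icc (-L) L, ∀ u, Φ c u ∈ K) ∧
        ∀ c ∈ Icc (-L) L, ∀ u, Φ c u = u ↔
          IsSolWE T φ f q a e (weightedMean hT q a u) (IccExtend hT.le u) ∧
            u ⟨0, left_mem_Icc.2 hT.le⟩ = c := by
  have h0 : (0 : ℝ) ∈ Icc 0 T := left_mem_Icc.2 hT.le
  obtain ⟨ψ, hψ, hψc, hφψ, hψφ⟩ := exists_continuous_inverse hφ hφs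
  have hψ0 : ψ 0 = 0 := by simpa [hφ0] using hψφ 0
  obtain ⟨F, hF⟩ := exists_hasDerivAt_eq hf
  have hFc : Continuous F := continuous_iff_continuousAt.2 fun x => (hF x).continuousAt
  have hiff := isSolWE_iff_isLienardSol hT hφψ hψφ hψc hf hF hq ham ha hem he
  obtain ⟨D, hD0, hD⟩ := exists_forall_isLienardSol_abs_sub_le hT hφ hφc hφψ hψc hq ham ha hem he
    hqb
  have hosc : ∀ G, Continuous G → ∀ u : C(Icc (0:ℝ) T, ℝ),
      IsLienardSol T ψ G q a e (weightedMean hT q a u) (IccExtend hT.le u) →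
      ∀ t, |u t - u ⟨0, h0⟩| ≤ D := by
    intro G hG u hu t
    have h1 := hD G hG _ _ (abs_weightedMean_le hT ha hqb u) hu t t.2
    rwa [IccExtend_of_mem _ _ h0, IccExtend_of_mem _ _ t.2] at h1
  refine ⟨D, fun u hu => hosc F hFc u ((hiff _ _).1 hu), fun L => ?_⟩
  set M := max 0 L + D
  have hM : -M ≤ M := by linarith [le_max_left 0 L]
  set G : ℝ → ℝ := IccExtend hM fun x => F x
  have hG : Continuous G := (hFc.comp continuous_subtype_val).Icc_extend'
  obtain ⟨CG, hCG⟩ := (isCompact_Icc (a := -M) (b := M)).exists_bound_of_continuousOn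
    hFc.continuousOn
  obtain ⟨K, Φ, hK, hKc, hΦ, hΦK, hfix⟩ := exists_operator_isLienardSol hT hψ hψc hψ0 hG
    (CG := CG) (fun x => hCG _ (projIcc (-M) M hM x).2) hq ham ha hem he he0 hqb L
  refine ⟨K, Φ, hK, hKc, hΦ, hΦK, fun c hc u => ?_⟩
  rw [hfix, hiff]
  have hGF : (∀ t, |u t - u ⟨0, h0⟩| ≤ D) → u ⟨0, h0⟩ = c →
      ∀ t ∈ Icc 0 T, G (IccExtend hT.le u t) = F (IccExtend hT.le u t) := by
    intro hb hu0 t ht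
    refine IccExtend_of_mem hM _ ?_
    have h1 := abs_le.1 (hb ⟨t, ht⟩)
    rw [IccExtend_of_mem _ _ ht]
    rw [hu0] at h1
    have h2 := le_max_right 0 L
    constructor <;> linarith [hc.1, hc.2, h1.1, h1.2]
  constructor
  · rintro ⟨hu, hu0⟩
    exact ⟨hu.congr hT (hGF (hosc G hG u hu) hu0) fun _ _ => rfl, hu0⟩
  · rintro ⟨hu, hu0⟩
    exact ⟨hu.congr hT (fun t ht => (hGF (hosc F hFc u hu) hu0 t ht).symm) fun _ _ => rfl, hu0⟩

theorem exists_forall_abs_le_of_tendsto {q : ℝ → ℝ} (hq : Continuous q) {ω : ℝ}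
    (htop : Tendsto q atTop (nhds ω)) (hbot : Tendsto q atBot (nhds ω)) :
    ∃ C, ∀ x, |q x| ≤ C := by
  obtain ⟨A, hA⟩ := eventually_atTop.1 (htop.abs.eventually (gt_mem_nhds (lt_add_one |ω|)))
  obtain ⟨B, hB⟩ := eventually_atBot.1 (hbot.abs.eventually (gt_mem_nhds (lt_add_one |ω|)))
  obtain ⟨C, hC⟩ := (isCompact_Icc (a := B) (b := A)).exists_bound_of_continuousOn hq.continuousOn
  refine ⟨max C (|ω| + 1), fun x => ?_⟩
  rcases le_total A x with hx | hx
  · exact (hA x hx).le.trans (le_max_right _ _)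
  rcases le_total x B with hx' | hx'
  · exact (hB x hx').le.trans (le_max_right _ _)
  · exact (hC x ⟨hx', hx⟩).trans (le_max_left _ _)

theorem exists_forall_le_abs_lt {q : ℝ → ℝ} {ω : ℝ}
    (htop : Tendsto q atTop (nhds ω)) (hbot : Tendsto q atBot (nhds ω))
    (hgt : ∃ R : ℝ, 0 < R ∧ ∀ u : ℝ, R ≤ |u| → ω < q u) {s : ℝ} (hs : ω < s) :
    ∃ R, 0 < R ∧ ∀ x, R ≤ |x| → ω < q x ∧ q x < s := by
  obtain ⟨A, hA⟩ := eventually_atTop.1 (htop.eventually (gt_mem_nhds hs))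
  obtain ⟨B, hB⟩ := eventually_atBot.1 (hbot.eventually (gt_mem_nhds hs))
  obtain ⟨R, hR0, hR⟩ := hgt
  refine ⟨max R (max A (-B)), lt_max_of_lt_left hR0, fun x hx => ?_⟩
  obtain ⟨h1, h2⟩ := max_le_iff.1 hx
  obtain ⟨h2, h3⟩ := max_le_iff.1 h2
  refine ⟨hR x h1, ?_⟩
  rcases abs_cases x with ⟨hx', -⟩ | ⟨hx', -⟩
  · exact hA x (by linarith)
  · exact hB x (by linarith)

/-- The Ambrosetti-Prodi alternative when the coefficients are bounded everywhere. -/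
theorem exists_threshold_of_forall_abs_le (hT : 0 < T) {φ f q a e : ℝ → ℝ} (hφ : StrictMono φ)
    (hφc : Continuous φ) (hφs : Function.Surjective φ) (hφ0 : φ 0 = 0) (hf : Continuous f)
    (hq : Continuous q) (ham : Measurable a) {Ca : ℝ} (ha : ∀ t, |a t| ≤ Ca)
    (ha0 : ∀ t, 0 ≤ a t) (ha1 : ∫ t in (0:ℝ)..T, a t = T)
    (hem : Measurable e) {Ce : ℝ} (he : ∀ t, |e t| ≤ Ce) (he0 : ∫ t in (0:ℝ)..T, e t = 0) {ω : ℝ}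
    (htop : Tendsto q atTop (nhds ω)) (hbot : Tendsto q atBot (nhds ω))
    (hgt : ∃ R : ℝ, 0 < R ∧ ∀ u : ℝ, R ≤ |u| → ω < q u) :
    ∃ s₀ : ℝ, ω < s₀ ∧
      (∀ s : ℝ, s₀ < s → ¬∃ u : ℝ → ℝ, IsSolWE T φ f q a e s u) ∧
      (∃ u : ℝ → ℝ, IsSolWE T φ f q a e s₀ u) ∧
      (∀ s : ℝ, ω < s → s < s₀ → ∃ u₁ u₂ : ℝ → ℝ, IsSolWE T φ f q a e s u₁ ∧
        IsSolWE T φ f q a e s u₂ ∧ ∃ t ∈ Icc (0:ℝ) T, u₁ t ≠ u₂ t) ∧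
      ((∀ u : ℝ, ω < q u) →
        ∀ s : ℝ, s ≤ ω → ¬∃ u : ℝ → ℝ, IsSolWE T φ f q a e s u) := by
  obtain ⟨Cq, hqb⟩ := exists_forall_abs_le_of_tendsto hq htop hbot
  obtain ⟨D, hD, hop⟩ := exists_operator_isSolWE hT hφ hφc hφs hφ0 hf hq ham ha hem he he0 hqb
  set o : Icc (0:ℝ) T := ⟨0, left_mem_Icc.2 hT.le⟩ with ho
  have : Nonempty (Icc (0:ℝ) T) := ⟨o⟩
  have hcomp : ∀ {s v}, IsSolWE T φ f q a e s v → ∃ u : C(Icc (0:ℝ) T, ℝ),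
      s = weightedMean hT q a u ∧ IsSolWE T φ f q a e s (IccExtend hT.le u) :=
    fun hv => hv.exists_continuousMap hT hφ hφs hf hq ham ha hem he he0
  set σ := weightedMean hT q a with hσ
  have hσc : Continuous σ := continuous_weightedMean hT hq ham ha
  have hoc : Continuous fun u : C(Icc (0:ℝ) T, ℝ) => u o := continuous_eval_const o
  have hfar : ∀ s, ω < s → ∃ R, 0 < R ∧ ∀ u : C(Icc (0:ℝ) T, ℝ),
      IsSolWE T φ f q a e (σ u) (IccExtend hT.le u) → R ≤ |u o| → ω < σ u ∧ σ u < s := by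
    intro s hs
    obtain ⟨R, hR0, hR⟩ := exists_forall_le_abs_lt htop hbot hgt hs
    refine ⟨R + |D|, by positivity, fun u hu huR => ?_⟩
    have hub : ∀ t, R ≤ |u t| := fun t => by
      have h1 := hD u hu t
      have h2 := abs_sub_abs_le_abs_sub (u o) (u t)
      rw [abs_sub_comm] at h2
      linarith [le_abs_self D]
    exact ⟨lt_weightedMean hT hq ham ha ha0 ha1 fun t => (hR _ (hub t)).1,
      weightedMean_lt hT hq ham ha ha0 ha1 fun t => (hR _ (hub t)).2⟩
  have hzero : ∀ L, 0 < L → ∀ g : ℝ → C(Icc (0:ℝ) T, ℝ) → ℝ,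
      Continuous (fun p : ℝ × C(Icc (0:ℝ) T, ℝ) => g p.1 p.2) →
      (∀ u : C(Icc (0:ℝ) T, ℝ), IsSolWE T φ f q a e (σ u) (IccExtend hT.le u) → u o = -L →
        g (-L) u < 0) →
      (∀ u : C(Icc (0:ℝ) T, ℝ), IsSolWE T φ f q a e (σ u) (IccExtend hT.le u) → u o = L →
        0 < g L u) →
      ∃ u : C(Icc (0:ℝ) T, ℝ), IsSolWE T φ f q a e (σ u) (IccExtend hT.le u) ∧ g (u o) u = 0 := by
    intro L hL g hg hneg hpos
    obtain ⟨K, Φ, hK, hKc, hΦ, hΦK, hfix⟩ := hop L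
    obtain ⟨c, hc, u, -, hu, hgu⟩ := exists_fixedPoint_eq_zero hK hKc
      ⟨Φ L 0, hΦK L ⟨by linarith, le_rfl⟩ 0⟩ hL.le Φ hΦ.continuousOn
      (fun c hc u _ => hΦK c hc u) g hg.continuousOn
      (fun u _ hu => by
        obtain ⟨h1, h2⟩ := (hfix _ ⟨le_rfl, by linarith⟩ u).1 hu
        exact hneg u h1 h2)
      (fun u _ hu => by
        obtain ⟨h1, h2⟩ := (hfix _ ⟨by linarith, le_rfl⟩ u).1 hu
        exact hpos u h1 h2)
    obtain ⟨h1, h2⟩ := (hfix c hc u).1 hu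
    exact ⟨u, h1, by rw [h2, hgu]⟩
  obtain ⟨u₁, hu₁, hσu₁⟩ : ∃ u : C(Icc (0:ℝ) T, ℝ),
      IsSolWE T φ f q a e (σ u) (IccExtend hT.le u) ∧ ω < σ u := by
    obtain ⟨R, hR0, hR⟩ := hfar (ω + 1) (by linarith)
    obtain ⟨u, hu, hu0⟩ := hzero (R + 1) (by linarith) (fun c _ => c - R) (by fun_prop)
      (fun _ _ _ => by linarith) (fun _ _ _ => by linarith)
    exact ⟨u, hu, (hR u hu (by rw [sub_eq_zero.1 hu0]; exact le_abs_self R)).1⟩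
  obtain ⟨α, hα, hαmax⟩ : ∃ α : C(Icc (0:ℝ) T, ℝ),
      IsSolWE T φ f q a e (σ α) (IccExtend hT.le α) ∧
      ∀ u : C(Icc (0:ℝ) T, ℝ), IsSolWE T φ f q a e (σ u) (IccExtend hT.le u) → σ u ≤ σ α := by
    obtain ⟨R, hR0, hR⟩ := hfar (σ u₁) hσu₁
    obtain ⟨K, Φ, hK, -, hΦ, hΦK, hfix⟩ := hop R
    set S := {u : C(Icc (0:ℝ) T, ℝ) | u ∈ K ∧ u o ∈ Icc (-R) R ∧ Φ (u o) u = u} with hS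
    have hScomp : IsCompact S := hK.inter_right
      ((isClosed_Icc.preimage hoc).inter
        (isClosed_eq (hΦ.comp (hoc.prodMk continuous_id)) continuous_id))
    have hmem : ∀ u : C(Icc (0:ℝ) T, ℝ), IsSolWE T φ f q a e (σ u) (IccExtend hT.le u) →
        σ u₁ ≤ σ u → u ∈ S := by
      intro u hu hle
      have h1 : u o ∈ Icc (-R) R := by
        refine abs_le.1 ?_
        by_contra! hlt
        exact (hR u hu hlt.le).2.not_ge hle
      have h2 : Φ (u o) u = u := (hfix _ h1 u).2 ⟨hu, rfl⟩
      exact ⟨h2 ▸ hΦK _ h1 u, h1, h2⟩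
    obtain ⟨α, ⟨-, hα1, hα2⟩, hαmax⟩ := hScomp.exists_isMaxOn ⟨u₁, hmem u₁ hu₁ le_rfl⟩
      hσc.continuousOn
    refine ⟨α, ((hfix _ hα1 α).1 hα2).1, fun u hu => ?_⟩
    rcases le_total (σ u₁) (σ u) with h | h
    · exact hαmax (hmem u hu h)
    · exact h.trans (hαmax (hmem u₁ hu₁ le_rfl))
  refine ⟨σ α, hσu₁.trans_le (hαmax u₁ hu₁), ?_, ⟨_, hα⟩, ?_, ?_⟩
  · rintro s hs ⟨v, hv⟩
    obtain ⟨u, rfl, hu⟩ := hcomp hv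
    exact (hαmax u hu).not_gt hs
  · intro s hsω hs
    obtain ⟨R, hR0, hR⟩ := hfar s hsω
    obtain ⟨m, hmc, hmex, hmle⟩ := exists_continuous_min (X := Icc (0:ℝ) T)
    have hmc' : Continuous fun u => m (u - α) := hmc.comp (continuous_id.sub continuous_const)
    set L := max R (‖α‖ + |D| + 1) with hL
    have hL0 : 0 < L := lt_max_of_lt_left hR0
    have hαb : ∀ t, |α t| ≤ L - |D| - 1 := fun t => by
      linarith [α.norm_coe_le_norm t, le_max_right R (‖α‖ + |D| + 1), Real.norm_eq_abs (α t)]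
    have hsmall : ∀ u : C(Icc (0:ℝ) T, ℝ), IsSolWE T φ f q a e (σ u) (IccExtend hT.le u) →
        |u o| = L → σ u < s := fun u hu huo => (hR u hu (huo ▸ le_max_left _ _)).2
    have hbelow : ∀ u : C(Icc (0:ℝ) T, ℝ), IsSolWE T φ f q a e (σ u) (IccExtend hT.le u) →
        u o = -L → m (u - α) < 0 := by
      intro u hu huo
      have h1 := hmle (u - α) o
      have h2 := abs_le.1 (hαb o)
      rw [ContinuousMap.sub_apply, huo] at h1
      linarith [abs_nonneg D, h2.1]
    have habove : ∀ u : C(Icc (0:ℝ) T, ℝ), IsSolWE T φ f q a e (σ u) (IccExtend hT.le u) →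
        u o = L → 0 < m (u - α) := by
      intro u hu huo
      obtain ⟨t, ht⟩ := hmex (u - α)
      rw [ht, ContinuousMap.sub_apply]
      have h1 := abs_le.1 (hD u hu t)
      have h2 := abs_le.1 (hαb t)
      linarith [h1.1, h2.2, le_abs_self D]
    have htouch : ∀ u : C(Icc (0:ℝ) T, ℝ), IsSolWE T φ f q a e (σ u) (IccExtend hT.le u) →
        σ u ≤ s → m (u - α) ≠ 0 := by
      intro u hu hus hm0
      obtain ⟨t, ht⟩ := hmex (u - α)
      have h1 := IsSolWE.lt_of_le hT hφ hf hq ha (hus.trans_lt hs) hu hα (fun r hr => by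
        have h2 := hmle (u - α) ⟨r, hr⟩
        rw [hm0, ContinuousMap.sub_apply] at h2
        rw [IccExtend_of_mem _ _ hr, IccExtend_of_mem _ _ hr]
        linarith) t t.2
      rw [IccExtend_of_mem _ _ t.2, IccExtend_of_mem _ _ t.2] at h1
      rw [hm0, ContinuousMap.sub_apply] at ht
      linarith
    obtain ⟨v, hv, hv0⟩ := hzero L hL0 (fun _ u => max (m (u - α)) (σ u - s))
      ((hmc'.max (hσc.sub continuous_const)).comp continuous_snd)
      (fun u hu huo => max_lt (hbelow u hu huo)
        (sub_neg.2 (hsmall u hu (by rw [huo, abs_neg, abs_of_pos hL0]))))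
      (fun u hu huo => lt_max_of_lt_left (habove u hu huo))
    obtain ⟨w, hw, hw0⟩ := hzero L hL0 (fun _ u => min (m (u - α)) (s - σ u))
      ((hmc'.min (continuous_const.sub hσc)).comp continuous_snd)
      (fun u hu huo => min_lt_of_left_lt (hbelow u hu huo))
      (fun u hu huo => lt_min (habove u hu huo)
        (sub_pos.2 (hsmall u hu (by rw [huo, abs_of_pos hL0]))))
    have hvm : m (v - α) < 0 ∧ σ v = s := by
      have h1 := (le_max_left (m (v - α)) (σ v - s)).trans_eq hv0
      have h2 := (le_max_right (m (v - α)) (σ v - s)).trans_eq hv0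
      have h3 := lt_of_le_of_ne h1 (htouch v hv (by linarith))
      rcases max_choice (m (v - α)) (σ v - s) with h4 | h4
      · exact absurd (h4.symm.trans hv0) h3.ne
      · exact ⟨h3, sub_eq_zero.1 (h4.symm.trans hv0)⟩
    have hwm : 0 < m (w - α) ∧ σ w = s := by
      have h1 := hw0.symm.trans_le (min_le_left (m (w - α)) (s - σ w))
      have h2 := hw0.symm.trans_le (min_le_right (m (w - α)) (s - σ w))
      have h3 := lt_of_le_of_ne h1 (htouch w hw (by linarith)).symm
      rcases min_choice (m (w - α)) (s - σ w) with h4 | h4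
      · exact absurd (h4.symm.trans hw0) h3.ne'
      · exact ⟨h3, (sub_eq_zero.1 (h4.symm.trans hw0)).symm⟩
    obtain ⟨t, ht⟩ := hmex (v - α)
    refine ⟨_, _, hvm.2 ▸ hv, hwm.2 ▸ hw, t, t.2, ?_⟩
    rw [IccExtend_of_mem _ _ t.2, IccExtend_of_mem _ _ t.2]
    have h1 := hmle (w - α) t
    rw [ContinuousMap.sub_apply] at ht h1
    refine ne_of_lt ?_
    change v t < w t
    linarith [hvm.1, hwm.1]
  · rintro hqω s hs ⟨v, hv⟩
    obtain ⟨u, rfl, hu⟩ := hcomp hv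
    exact (lt_weightedMean hT hq ham ha ha0 ha1 fun t => hqω (u t)).not_ge hs

theorem isSolWE_congr_ae {φ f q a a₁ e e₁ : ℝ → ℝ} (ha : a =ᵐ[muT T] a₁) (he : e =ᵐ[muT T] e₁)
    (s : ℝ) (u : ℝ → ℝ) : IsSolWE T φ f q a e s u ↔ IsSolWE T φ f q a₁ e₁ s u := by
  refine exists_congr fun u' => exists_congr fun w => and_congr_right fun _ =>
    and_congr_right fun _ => eventually_congr ?_
  filter_upwards [ha, he] with t h1 h2
  rw [h1, h2]

theorem exists_measurable_forall_mem_Icc_ae_eq {a : ℝ → ℝ} (ham : Measurable a) {l r : ℝ}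
    (hlr : l ≤ r) {μ : Measure ℝ} (ha : ∀ᵐ t ∂μ, a t ∈ Icc l r) :
    ∃ b : ℝ → ℝ, Measurable b ∧ (∀ t, b t ∈ Icc l r) ∧ a =ᵐ[μ] b := by
  refine ⟨fun t => max l (min (a t) r), by fun_prop,
    fun t => ⟨le_max_left _ _, max_le hlr (min_le_right _ _)⟩, ?_⟩
  filter_upwards [ha] with t ht
  rw [min_eq_left ht.2, max_eq_right ht.1]

end

/-- If `q(u) → ω ∈ ℝ` as `u → ±∞` and `q(u) > ω` for all `|u|` large, then there is
`s₀ > ω` such that `(WE_s)` has no `T`-periodic solution for `s > s₀`, at least one for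
`s = s₀`, and at least two for `ω < s < s₀`; moreover, if `q(u) > ω` for all `u`, then
for `s ≤ ω` there are no `T`-periodic solutions. -/
theorem statement1
    (T : ℝ) (hT : 0 < T)
    (φ f q a e : ℝ → ℝ)
    (hφmono : StrictMono φ) (hφcont : Continuous φ)
    (hφsurj : Function.Surjective φ) (hφ0 : φ 0 = 0)
    (hf : Continuous f) (hq : Continuous q)
    (ha_meas : Measurable a) (ha_bdd : ∃ C : ℝ, ∀ᵐ t ∂(muT T), |a t| ≤ C)
    (ha_nonneg : ∀ᵐ t ∂(muT T), 0 ≤ a t)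
    (ha_mean : (1 / T) * ∫ t in Icc (0:ℝ) T, a t = 1)
    (he_meas : Measurable e) (he_bdd : ∃ C : ℝ, ∀ᵐ t ∂(muT T), |e t| ≤ C)
    (he_mean : (1 / T) * ∫ t in Icc (0:ℝ) T, e t = 0)
    (ω : ℝ)
    (hq_top : Tendsto q atTop (nhds ω)) (hq_bot : Tendsto q atBot (nhds ω))
    (hq_gt : ∃ R : ℝ, 0 < R ∧ ∀ u : ℝ, R ≤ |u| → ω < q u) :
    ∃ s₀ : ℝ, ω < s₀ ∧
      (∀ s : ℝ, s₀ < s → ¬∃ u : ℝ → ℝ, IsSolWE T φ f q a e s u) ∧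
      (∃ u : ℝ → ℝ, IsSolWE T φ f q a e s₀ u) ∧
      (∀ s : ℝ, ω < s → s < s₀ → ∃ u₁ u₂ : ℝ → ℝ, IsSolWE T φ f q a e s u₁ ∧
        IsSolWE T φ f q a e s u₂ ∧ ∃ t ∈ Icc (0:ℝ) T, u₁ t ≠ u₂ t) ∧
      ((∀ u : ℝ, ω < q u) →
        ∀ s : ℝ, s ≤ ω → ¬∃ u : ℝ → ℝ, IsSolWE T φ f q a e s u) := by
  obtain ⟨Ca, hCa⟩ := ha_bdd
  obtain ⟨Ce, hCe⟩ := he_bdd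
  obtain ⟨a₁, ha₁m, ha₁, haa⟩ := exists_measurable_forall_mem_Icc_ae_eq ha_meas (abs_nonneg Ca)
    (μ := muT T) (by
      filter_upwards [hCa, ha_nonneg] with t h1 h2
      exact ⟨h2, (le_abs_self _).trans (h1.trans (le_abs_self _))⟩)
  obtain ⟨e₁, he₁m, he₁, hee⟩ := exists_measurable_forall_mem_Icc_ae_eq he_meas
    (neg_le_self (abs_nonneg Ce)) (μ := muT T) (by
      filter_upwards [hCe] with t h1
      exact abs_le.1 (h1.trans (le_abs_self _)))
  have hint : ∀ {b b₁ : ℝ → ℝ}, b =ᵐ[muT T] b₁ →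
      ∫ t in (0:ℝ)..T, b₁ t = ∫ t in Icc (0:ℝ) T, b t := by
    intro b b₁ hb
    rw [intervalIntegral.integral_of_le hT.le, ← integral_Icc_eq_integral_Ioc]
    exact (integral_congr_ae hb).symm
  simp only [isSolWE_congr_ae haa hee]
  refine exists_threshold_of_forall_abs_le hT hφmono hφcont hφsurj hφ0 hf hq ha₁m
    (fun t => abs_le.2 ⟨(neg_nonpos.2 (abs_nonneg Ca)).trans (ha₁ t).1, (ha₁ t).2⟩)
    (fun t => (ha₁ t).1) ?_ he₁m (fun t => abs_le.2 (he₁ t)) ?_ hq_top hq_bot hq_gt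
  · rw [hint haa]
    field_simp at ha_mean
    exact ha_mean
  · rw [hint hee]
    exact (mul_eq_zero.1 he_mean).resolve_left (one_div_pos.2 hT).ne'

end
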